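/- arXiv:2209.13339 — 2 statements merged into one kernel-verified Lean document; each statement's English description precedes it below -/
import Mathlib

section
/- Suppose q is odd, n ≥ 5, and let B be a small minimal blocking set in PG(2,q^n) of Rédei type with Rédei line ℓ_∞. Suppose that for every line s ≠ ℓ_∞, |s ∩ B| ∈ {1, q+1, q^{n−2}+1}, and for each of the three values there is at least one line s ≠ ℓ_∞ with that intersection size. Then B is PGL(3,q^n)-equivalent to L_{Ū}, where Ū has the following form: there exist integers t ≥ 2, ℓ ≥ 0 with n = t(ℓ+1), elements a, b, c ∈ 𝔽_{q^n}^*, and an 𝔽_q(b)-subspace S̄ of 𝔽_{q^n} with [𝔽_q(b):𝔽_q] = t, dim_{𝔽_q(b)}(S̄) = ℓ, c·𝔽_q(b) ∩ S̄ = {0}, 1 ∈ S̄ ⊕ c·⟨1, b, …, b^{t−2}⟩_{𝔽_q}, a ∉ S̄ ⊕ c·⟨1, b, …, b^{t−2}⟩_{𝔽_q}, such that Ū = {(s̄ + Σ_{i=0}^{t−3} c x_i b^i + α + β a, α + β b, δ) : x_i, α, β, δ ∈ 𝔽_q, s̄ ∈ S̄} ⊆ 𝔽_{q^n}³. -/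
open scoped Pointwise

open Polynomial in
/-- The Rédei polynomial `∏ (S - (u₁ - u₂ T))` of a finite set of points of the affine plane. -/
noncomputable def redeiPoly {L : Type*} [Field L] (U : Finset (L × L)) :
    Polynomial (Polynomial L) :=
  ∏ u ∈ U, (X - C (C u.1 - X * C u.2))

open Polynomial in
theorem redeiPoly_coeff_coeff_eq_zero {L : Type*} [Field L] (U : Finset (L × L)) :
    ∀ k j : ℕ, U.card < k + j → ((redeiPoly U).coeff k).coeff j = 0 := by
  classical
  unfold redeiPoly
  induction U using Finset.induction_on with
  | empty =>
    intro k j h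
    rw [Finset.prod_empty, coeff_one]
    split_ifs with hk
    · rw [coeff_one, if_neg]
      simp at h; omega
    · simp
  | insert a U ha ih =>
    intro k j h
    rw [Finset.card_insert_of_notMem ha] at h
    rw [Finset.prod_insert ha, sub_mul, coeff_sub, coeff_sub, coeff_C_mul, sub_mul, coeff_sub,
      coeff_C_mul, ih k j (by omega), mul_assoc X]
    have h1 : ((X * ∏ u ∈ U, (X - C (C u.1 - X * C u.2))).coeff k).coeff j = 0 := by
      rcases k with _ | k
      · simp
      · rw [coeff_X_mul, ih k j (by omega)]
    have h2 : (X * (C a.2 * (∏ u ∈ U, (X - C (C u.1 - X * C u.2))).coeff k)).coeff j = 0 := by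
      rcases j with _ | j
      · simp
      · rw [coeff_X_mul, coeff_C_mul, ih k j (by omega), mul_zero]
    rw [h1, h2]; simp

/-- Every class of parallel lines either meets `U` in exactly one point each, or in a multiple of
`q` points each. -/
def DirDivisible {L : Type*} [Field L] [DecidableEq L] (q : ℕ) (U : Finset (L × L)) : Prop :=
  ∀ t : L, (∀ s : L, (U.filter fun v => v.1 - t * v.2 = s).card = 1) ∨
    (∀ s : L, q ∣ (U.filter fun v => v.1 - t * v.2 = s).card)

open Polynomial in
theorem coeff_prod_eq_zero_of_not_dvd {R ι : Type*} [CommRing R] {q : ℕ} (A : Finset ι)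
    (f : ι → R[X]) (hf : ∀ i ∈ A, ∀ k, ¬ q ∣ k → (f i).coeff k = 0) :
    ∀ k, ¬ q ∣ k → (∏ i ∈ A, f i).coeff k = 0 := by
  classical
  induction A using Finset.induction_on with
  | empty =>
    intro k hk
    rw [Finset.prod_empty, coeff_one, if_neg]
    rintro rfl; simp at hk
  | insert a A ha ih =>
    intro k hk
    rw [Finset.prod_insert ha, coeff_mul]
    refine Finset.sum_eq_zero fun x hx => ?_
    replace hx : x.1 + x.2 = k := by simpa using hx
    by_cases h1 : q ∣ x.1
    · have h2 : ¬ q ∣ x.2 := fun h2 => hk (hx ▸ dvd_add h1 h2)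
      rw [ih (fun i hi => hf i (Finset.mem_insert_of_mem hi)) _ h2, mul_zero]
    · rw [hf a (Finset.mem_insert_self _ _) _ h1, zero_mul]

open Polynomial in
theorem sub_pow_card_of_algebra {K : Type*} [Field K] [Fintype K] {R : Type*}
    [CommRing R] [Algebra K R] [Nontrivial R] (x y : R) :
    (x - y) ^ Fintype.card K = x ^ Fintype.card K - y ^ Fintype.card K := by
  obtain ⟨p, hp⟩ := CharP.exists K
  obtain ⟨m, hpp, hm⟩ := FiniteField.card K p
  have := Fact.mk hpp
  have : CharP R p := charP_of_injective_algebraMap (algebraMap K R).injective p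
  rw [hm]
  exact sub_pow_expChar_pow x y m

theorem natCast_card_eq_zero_of_algebra {K L : Type*} [Field K] [Fintype K] [Field L]
    [Algebra K L] : ((Fintype.card K : ℕ) : L) = 0 := by
  have : ((Fintype.card K : ℕ) : K) = 0 := FiniteField.cast_card_eq_zero K
  rw [← map_natCast (algebraMap K L), this, map_zero]

open Polynomial in
theorem redeiPoly_coeff_eq_zero {K L : Type*} [Field K] [Field L] [Algebra K L] [Fintype K]
    [Fintype L] [DecidableEq L] (U : Finset (L × L)) (hU : U.card = Fintype.card L)
    (hdiv : Fintype.card K ∣ Fintype.card L)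
    (hd : DirDivisible (Fintype.card K) U) (k : ℕ) (hk : ¬ Fintype.card K ∣ k) (hk1 : k ≠ 1) :
    (redeiPoly U).coeff k = 0 := by
  have hk0 : k ≠ 0 := by rintro rfl; simp at hk
  have hdeg : ((redeiPoly U).coeff k).natDegree ≤ U.card - k := by
    rw [natDegree_le_iff_coeff_eq_zero]
    intro j hj
    exact redeiPoly_coeff_coeff_eq_zero U k j (by omega)
  have hcard : 0 < Fintype.card L := Fintype.card_pos
  refine eq_zero_of_natDegree_lt_card_of_eval_eq_zero' _ Finset.univ (fun t _ => ?_)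
    (by rw [Finset.card_univ]; omega)
  have hmap : (redeiPoly U).map (evalRingHom t) = ∏ u ∈ U, (X - C (u.1 - t * u.2)) := by
    rw [redeiPoly, Polynomial.map_prod]
    refine Finset.prod_congr rfl fun u _ => ?_
    simp only [Polynomial.map_sub, Polynomial.map_mul, map_X, map_C, coe_evalRingHom, eval_C,
      eval_X, map_sub, map_mul]
  have hev : eval t ((redeiPoly U).coeff k) = (∏ u ∈ U, (X - C (u.1 - t * u.2))).coeff k := by
    rw [← hmap, coeff_map]; rfl
  have hfib : ∏ u ∈ U, (X - C (u.1 - t * u.2)) =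
      ∏ s : L, (X - C s) ^ (U.filter fun v => v.1 - t * v.2 = s).card := by
    rw [← Finset.prod_fiberwise U (fun v => v.1 - t * v.2)]
    refine Finset.prod_congr rfl fun s _ => ?_
    rw [Finset.prod_congr rfl (g := fun _ => X - C s)
      (fun u hu => by rw [(Finset.mem_filter.1 hu).2])]
    rw [Finset.prod_const]
  rw [hev, hfib]
  rcases hd t with h1 | h1
  · have : ∏ s : L, (X - C s) ^ (U.filter fun v => v.1 - t * v.2 = s).card
        = X ^ Fintype.card L - X := by
      simp only [h1, pow_one]
      have hr := FiniteField.roots_X_pow_card_sub_X L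
      have hmon : (X ^ Fintype.card L - X : L[X]).Monic :=
        monic_X_pow_sub (by rw [degree_X]; exact_mod_cast Fintype.one_lt_card)
      have := prod_multiset_X_sub_C_of_monic_of_roots_card_eq hmon (by
        rw [hr, FiniteField.X_pow_card_sub_X_natDegree_eq L Fintype.one_lt_card]; rfl)
      rw [hr] at this
      exact this
    rw [this, coeff_sub, coeff_X_pow, coeff_X, if_neg, if_neg (Ne.symm hk1), sub_zero]
    rintro rfl; exact hk hdiv
  · refine coeff_prod_eq_zero_of_not_dvd _ _ (fun s _ j hj => ?_) k hk
    obtain ⟨m, hm⟩ := h1 s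
    rw [hm, pow_mul, sub_pow_card_of_algebra (K := K), ← C_pow, ← Finset.card_range m,
      ← Finset.prod_const]
    refine coeff_prod_eq_zero_of_not_dvd _ _ (fun _ _ i hi => ?_) j hj
    rw [coeff_sub, coeff_X_pow, if_neg (by rintro rfl; exact hi dvd_rfl), coeff_C,
      if_neg (by rintro rfl; exact hi (dvd_zero _)), sub_zero]

open Polynomial in
/-- The number of further points of `U` on the line of slope `t` through `u ∈ U` does not depend
on `u`. -/
theorem card_line_eq_card_line {K L : Type*} [Field K] [Field L] [Algebra K L] [Fintype K]
    [Fintype L] [DecidableEq L] (U : Finset (L × L)) (hU : U.card = Fintype.card L)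
    (hdiv : Fintype.card K ∣ Fintype.card L)
    (hd : DirDivisible (Fintype.card K) U) (t : L) (u v : L × L) (hu : u ∈ U) (hv : v ∈ U) :
    (U.filter fun w => w.1 - t * w.2 = u.1 - t * u.2).card =
      (U.filter fun w => w.1 - t * w.2 = v.1 - t * v.2).card := by
  have hder : derivative (redeiPoly U) = C ((redeiPoly U).coeff 1) := by
    ext1 k
    rw [coeff_derivative, coeff_C]
    split_ifs with hk
    · subst hk; simp
    · by_cases hq : Fintype.card K ∣ k + 1
      · obtain ⟨m, hm⟩ := hq
        have h0 : ((k : Polynomial L) + 1) = 0 := by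
          have : ((k + 1 : ℕ) : Polynomial L) = 0 := by
            rw [hm, Nat.cast_mul, ← map_natCast (C : L →+* L[X]),
              natCast_card_eq_zero_of_algebra (K := K)]
            simp
          exact_mod_cast this
        rw [h0, mul_zero]
      · rw [redeiPoly_coeff_eq_zero (K := K) U hU hdiv hd (k + 1) hq (by omega), zero_mul]
  have key : ∀ u ∈ U, (redeiPoly U).coeff 1 =
      ∏ w ∈ U.erase u, (C (w.2 - u.2) * X - C (w.1 - u.1)) := by
    intro u hu
    have h1 : redeiPoly U = (X - C (C u.1 - X * C u.2)) *
        ∏ w ∈ U.erase u, (X - C (C w.1 - X * C w.2)) :=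
      (Finset.mul_prod_erase U (fun w => (X - C (C w.1 - X * C w.2) : L[X][X])) hu).symm
    have h2 : eval (C u.1 - X * C u.2) (derivative (redeiPoly U)) =
        (redeiPoly U).coeff 1 := by rw [hder, eval_C]
    rw [h1, derivative_mul] at h2
    rw [← h1] at h2
    rw [← h2]
    simp only [derivative_sub, derivative_X, derivative_C, sub_zero, one_mul, eval_add, eval_mul,
      eval_sub, eval_X, eval_C, sub_self, zero_mul, add_zero, eval_prod]
    refine Finset.prod_congr rfl fun w _ => ?_
    simp only [map_sub]
    ring
  have fac : ∀ u w : L × L, w ≠ u → (C (w.2 - u.2) * X - C (w.1 - u.1) : L[X]) ≠ 0 ∧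
      rootMultiplicity t (C (w.2 - u.2) * X - C (w.1 - u.1) : L[X]) =
        if w.1 - t * w.2 = u.1 - t * u.2 then 1 else 0 := by
    intro u w hw
    by_cases h2 : w.2 = u.2
    · have h1 : w.1 - u.1 ≠ 0 := fun h => hw (Prod.ext (sub_eq_zero.1 h) h2)
      rw [if_neg (by rw [h2]; intro h; exact h1 (by linear_combination h)), h2, sub_self, C_0,
        zero_mul, zero_sub, ← C_neg]
      exact ⟨by rw [Ne, C_eq_zero, neg_eq_zero]; exact h1, rootMultiplicity_C _ _⟩
    · have h2' : w.2 - u.2 ≠ 0 := sub_ne_zero.2 h2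
      constructor
      · intro h
        have := congrArg (fun p => coeff p 1) h
        simp [coeff_C] at this
        exact h2' this
      · rw [← count_roots, roots_C_mul_X_sub_C _ h2', Multiset.count_singleton]
        congr 1
        rw [eq_iff_iff, eq_inv_mul_iff_mul_eq₀ h2']
        constructor <;> intro h <;> linear_combination -h
  have mult : ∀ u ∈ U, rootMultiplicity t ((redeiPoly U).coeff 1) + 1 =
      (U.filter fun w => w.1 - t * w.2 = u.1 - t * u.2).card := by
    intro u hu
    have hne : ∏ w ∈ U.erase u, (C (w.2 - u.2) * X - C (w.1 - u.1) : L[X]) ≠ 0 :=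
      Finset.prod_ne_zero_iff.2 fun w hw => (fac u w (Finset.ne_of_mem_erase hw)).1
    rw [key u hu, ← count_roots, roots_prod _ _ hne, Multiset.count_bind]
    have : (Multiset.map (fun w => Multiset.count t
        (C (w.2 - u.2) * X - C (w.1 - u.1) : L[X]).roots) (U.erase u).val).sum =
        ∑ w ∈ U.erase u, if w.1 - t * w.2 = u.1 - t * u.2 then 1 else 0 := by
      change ∑ w ∈ U.erase u, _ = _
      refine Finset.sum_congr rfl fun w hw => ?_
      rw [count_roots, (fac u w (Finset.ne_of_mem_erase hw)).2]
    rw [this, ← Finset.card_filter, Finset.filter_erase, Finset.card_erase_add_one]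
    simp [hu]
  rw [← mult u hu, ← mult v hv]

open Polynomial in
theorem coeff_coeff_homogenize {L : Type*} [Field L] (R : L[X][X]) (k j : ℕ) :
    ((eval₂ (eval₂RingHom (C.comp C : L →+* L[X][X]) X) (C X * X) R).coeff j).coeff k =
      if k ≤ j then (R.coeff k).coeff (j - k) else 0 := by
  induction R using Polynomial.induction_on' with
  | add p q hp hq =>
    rw [eval₂_add, coeff_add, coeff_add, hp, hq, coeff_add, coeff_add]
    split_ifs <;> simp
  | monomial a r =>
    induction r using Polynomial.induction_on' with
    | add p q hp hq =>
      rw [map_add, eval₂_add, coeff_add, coeff_add, hp, hq, coeff_add, coeff_add]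
      split_ifs <;> simp
    | monomial b c =>
      rw [eval₂_monomial, coe_eval₂RingHom, eval₂_monomial]
      have : (C.comp C : L →+* L[X][X]) c * X ^ b * (C X * X) ^ a =
          C (C c * X ^ a) * X ^ (b + a) := by
        rw [RingHom.comp_apply, map_mul, map_pow]; ring
      rw [this, coeff_C_mul, coeff_X_pow, coeff_monomial]
      split_ifs with h1 h2 h3 h3 h4 <;> simp [coeff_X_pow, coeff_monomial]
      · rw [if_pos h3.symm, if_pos (by omega)]
      all_goals intro _; omega

open Polynomial in
theorem smul_mem_of_card_eq {K L : Type*} [Field K] [Field L] [Algebra K L] [Fintype K]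
    [Fintype L] [DecidableEq L] (U : Finset (L × L)) (hU : U.card = Fintype.card L)
    (hdiv : Fintype.card K ∣ Fintype.card L) (hd : DirDivisible (Fintype.card K) U)
    (h0 : (0, 0) ∈ U) (hZ : (U.filter fun v => v.1 = 0).card = Fintype.card K)
    (y : L) (hy : (0, y) ∈ U) (l : K) : (0, algebraMap K L l * y) ∈ U := by
  set q := Fintype.card K with hq
  have hq1 : 1 < q := Fintype.one_lt_card
  set Z := U.filter fun v => v.1 = 0 with hZdef
  set g : L[X] := ∏ v ∈ Z, (X + C v.2) with hg
  have hgdeg : g.natDegree = q := by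
    rw [hg, natDegree_prod_of_monic _ _ fun v _ => monic_X_add_C _]
    simp [hZ]
  have hgmon : g.Monic := monic_prod_of_monic _ _ fun v _ => monic_X_add_C _
  -- the lowest homogeneous part of the Rédei polynomial is a multiple of `g`
  set m : L := ∏ v ∈ U.filter (fun v => ¬ v.1 = 0), (- v.1) with hm
  have hm0 : m ≠ 0 := Finset.prod_ne_zero_iff.2 fun v hv => neg_ne_zero.2 (Finset.mem_filter.1 hv).2
  have hcoef : (eval₂ (eval₂RingHom (C.comp C : L →+* L[X][X]) X) (C X * X) (redeiPoly U)).coeff q =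
      g * C m := by
    have e1 : eval₂ (eval₂RingHom (C.comp C : L →+* L[X][X]) X) (C X * X) (redeiPoly U) =
        ∏ v ∈ U, (C (X + C v.2) * X - C (C v.1)) := by
      rw [redeiPoly, eval₂_finsetProd]
      refine Finset.prod_congr rfl fun v _ => ?_
      simp only [eval₂_sub, eval₂_X, eval₂_C, coe_eval₂RingHom, eval₂_mul, RingHom.comp_apply, map_add]
      ring
    have e2 : ∏ v ∈ Z, (C (X + C v.2) * X - C (C v.1) : L[X][X]) = C g * X ^ q := by
      rw [hg, map_prod, ← hZ, ← Finset.prod_const, ← Finset.prod_mul_distrib]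
      refine Finset.prod_congr rfl fun v hv => ?_
      rw [(Finset.mem_filter.1 hv).2]; simp
    rw [e1, ← Finset.prod_filter_mul_prod_filter_not U (fun v => v.1 = 0), ← hZdef, e2, mul_assoc,
      coeff_C_mul, coeff_X_pow_mul', if_pos le_rfl, Nat.sub_self, coeff_zero_eq_eval_zero, eval_prod,
      hm, map_prod]
    congr 1
    refine Finset.prod_congr rfl fun v hv => ?_
    simp
  have hgc : ∀ k, k ≠ 0 → k ≠ 1 → k ≠ q → g.coeff k = 0 := by
    intro k hk0 hk1 hkq
    by_cases hk : k ≤ q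
    · have h1 := coeff_coeff_homogenize (redeiPoly U) k q
      rw [hcoef, coeff_mul_C, redeiPoly_coeff_eq_zero (K := K) U hU hdiv hd k
        (fun h => hkq (le_antisymm hk (Nat.le_of_dvd (Nat.pos_of_ne_zero hk0) h))) hk1] at h1
      simpa [hm0] using h1
    · exact coeff_eq_zero_of_natDegree_lt (by omega)
  have hgeval : ∀ x : L, eval x g = g.coeff 0 + g.coeff 1 * x + x ^ q := by
    intro x
    rw [eval_eq_sum_range, hgdeg]
    have hs : ({0, 1, q} : Finset ℕ) ⊆ Finset.range (q + 1) := by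
      intro i hi; simp at hi ⊢; omega
    rw [← Finset.sum_subset hs]
    · rw [Finset.sum_insert (by simp; omega), Finset.sum_pair (by omega)]
      have : g.coeff q = 1 := by rw [← hgdeg]; exact hgmon
      rw [this]; ring
    · intro i _ hi
      simp at hi
      rw [hgc i hi.1 hi.2.1 hi.2.2, zero_mul]
  have hroot : ∀ x : L, (0, x) ∈ U ↔ eval (-x) g = 0 := by
    intro x
    rw [hg, eval_prod, Finset.prod_eq_zero_iff]
    constructor
    · intro h
      exact ⟨(0, x), Finset.mem_filter.2 ⟨h, rfl⟩, by simp⟩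
    · rintro ⟨v, hv, h⟩
      obtain ⟨hvU, hv1⟩ := Finset.mem_filter.1 hv
      have : v = (0, x) := Prod.ext hv1 (by simp at h; linear_combination h)
      exact this ▸ hvU
  have hc0 : g.coeff 0 = 0 := by
    have := (hroot 0).1 h0
    rw [hgeval] at this
    simpa [show q ≠ 0 by omega] using this
  rw [hroot, hgeval, hc0] at hy ⊢
  have hl : (algebraMap K L l) ^ q = algebraMap K L l := by
    rw [← map_pow, hq, FiniteField.pow_card]
  have : -(algebraMap K L l * y) = algebraMap K L l * -y := by ring
  rw [this, mul_pow, hl]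
  linear_combination algebraMap K L l * hy

/-- An affine line, not parallel to the first axis, meeting `U` in exactly `|K|` points meets it in
an affine subline over `K`. -/
theorem lineMap_mem_of_card_eq {K L : Type*} [Field K] [Field L] [Algebra K L] [Fintype K]
    [Fintype L] [DecidableEq L] (U : Finset (L × L)) (hU : U.card = Fintype.card L)
    (hdiv : Fintype.card K ∣ Fintype.card L) (hd : DirDivisible (Fintype.card K) U)
    (t : L) (u v : L × L) (hu : u ∈ U) (hv : v ∈ U) (huv : v.1 - t * v.2 = u.1 - t * u.2)
    (hZ : (U.filter fun w => w.1 - t * w.2 = u.1 - t * u.2).card = Fintype.card K) (l : K) :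
    u + l • (v - u) ∈ U := by
  let g : L × L ↪ L × L :=
    ⟨fun w => (w.1 - u.1 - t * (w.2 - u.2), w.2 - u.2), by
      intro w w' h
      obtain ⟨h1, h2⟩ := Prod.mk.inj h
      have h3 : w.2 = w'.2 := by linear_combination h2
      exact Prod.ext (by linear_combination h1 + t * h2) h3⟩
  have hcard : ∀ t' s : L, ((U.map g).filter fun v => v.1 - t' * v.2 = s).card =
      (U.filter fun v => v.1 - (t + t') * v.2 = s + u.1 - (t + t') * u.2).card := by
    intro t' s
    rw [Finset.filter_map, Finset.card_map]
    congr 1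
    refine Finset.filter_congr fun w _ => ?_
    change w.1 - u.1 - t * (w.2 - u.2) - t' * (w.2 - u.2) = s ↔ _
    constructor <;> intro h <;> linear_combination h
  have h := smul_mem_of_card_eq (K := K) (U.map g) (by rw [Finset.card_map, hU]) hdiv
    (fun t' => by
      simp only [hcard]
      exact (hd (t + t')).imp (fun h s => h _) (fun h s => h _))
    (Finset.mem_map.2 ⟨u, hu, Prod.ext (show u.1 - u.1 - t * (u.2 - u.2) = 0 by ring)
      (sub_self _)⟩)
    (by
      have := hcard 0 0
      simp only [zero_mul, sub_zero, add_zero, zero_add] at this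
      rw [this, hZ])
    (v.2 - u.2)
    (Finset.mem_map.2 ⟨v, hv, Prod.ext
      (show v.1 - u.1 - t * (v.2 - u.2) = 0 by linear_combination huv) rfl⟩) l
  obtain ⟨w, hw, hwg⟩ := Finset.mem_map.1 h
  obtain ⟨h1, h2⟩ := Prod.mk.inj hwg
  have : w = u + l • (v - u) := by
    refine Prod.ext ?_ ?_
    · rw [Prod.fst_add, Prod.smul_fst, Prod.fst_sub, Algebra.smul_def]
      linear_combination h1 + t * h2 - algebraMap K L l * huv
    · rw [Prod.snd_add, Prod.smul_snd, Prod.snd_sub, Algebra.smul_def]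
      linear_combination h2
  exact this ▸ hw

/-- A set containing the `K`-affine span of any two of its points with different second coordinates
is a subspace. -/
theorem exists_submodule_of_lineMap_mem {K L : Type*} [Field K] [Field L] [Algebra K L]
    (h2 : (2 : K) ≠ 0) (U : Set (L × L)) (h0 : (0 : L × L) ∈ U) (w : L × L) (hw : w ∈ U)
    (hw2 : w.2 ≠ 0)
    (hU : ∀ u ∈ U, ∀ v ∈ U, u.2 ≠ v.2 → ∀ l : K, u + l • (v - u) ∈ U) :
    ∃ M : Submodule K (L × L), (M : Set (L × L)) = U := by
  -- translations by differences of points on a common horizontal line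
  have s1 : ∀ p ∈ U, ∀ p' ∈ U, p.2 = p'.2 → ∀ r ∈ U, r.2 ≠ p.2 → ∀ l : K, l ≠ 1 →
      r + l • (p' - p) ∈ U := by
    intro p hp p' hp' hpp r hr hrp l hl
    have hl' : 1 - l ≠ 0 := sub_ne_zero.2 (Ne.symm hl)
    have hm : r + (-l / (1 - l)) • (p - r) ∈ U := hU r hr p hp hrp _
    have hne : (r + (-l / (1 - l)) • (p - r)).2 ≠ p'.2 := by
      rw [← hpp]
      intro h
      have h' : (1 - (-l / (1 - l))) • (r.2 - p.2) = 0 := by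
        simp at h
        rw [sub_smul, one_smul, ← sub_eq_zero.2 h]
        simp [smul_sub]
        abel
      have h3 : (1 - (-l / (1 - l))) = 1 / (1 - l) := by field_simp; ring
      rw [h3, smul_eq_zero] at h'
      rcases h' with h' | h'
      · exact one_div_ne_zero hl' h'
      · exact hrp (sub_eq_zero.1 h')
    have := hU _ hm _ hp' hne l
    convert this using 1
    have e : r + (-l / (1 - l)) • (p - r) + l • (p' - (r + (-l / (1 - l)) • (p - r))) =
      r + (-l / (1 - l) * (1 - l)) • (p - r) + l • (p' - r) := by module
    rw [e, div_mul_cancel₀ _ hl']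
    module
  have s2 : ∀ p ∈ U, ∀ p' ∈ U, p.2 = p'.2 → ∀ r ∈ U, r.2 ≠ p.2 → ∀ l : K,
      r + l • (p' - p) ∈ U := by
    intro p hp p' hp' hpp r hr hrp l
    by_cases hl : l = 1
    · have h12 : (1 / 2 : K) ≠ 1 := by
        intro h
        have : (1 : K) = 2 := by field_simp at h; exact h
        have : (1 : K) = 0 := by linear_combination -this
        exact one_ne_zero this
      have a1 := s1 p hp p' hp' hpp r hr hrp _ h12
      have a2 := s1 p hp p' hp' hpp _ a1 (by
        rw [Prod.snd_add, Prod.smul_snd, Prod.snd_sub, hpp, sub_self, smul_zero, add_zero, ← hpp]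
        exact hrp) _ h12
      convert a2 using 1
      rw [add_assoc, ← add_smul, hl]
      congr 2
      field_simp; ring
    · exact s1 p hp p' hp' hpp r hr hrp l hl
  have s3 : ∀ u ∈ U, ∀ v ∈ U, ∀ l : K, u + l • (v - u) ∈ U := by
    intro u hu v hv l
    by_cases huv : u.2 = v.2
    · obtain ⟨r, hr, hru⟩ : ∃ r ∈ U, r.2 ≠ u.2 := by
        by_cases h : u.2 = 0
        · exact ⟨w, hw, by rw [h]; exact hw2⟩
        · exact ⟨0, h0, Ne.symm h⟩
      have hr' := s2 u hu v hv huv r hr hru 1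
      have hr2 : (r + (1 : K) • (v - u)).2 = r.2 := by simp [huv]
      have := s2 r hr _ hr' hr2.symm u hu (Ne.symm hru) l
      simpa using this
    · exact hU u hu v hv huv l
  have hsmul : ∀ (l : K), ∀ u ∈ U, l • u ∈ U := by
    intro l u hu
    simpa using s3 0 h0 u hu l
  refine ⟨⟨⟨⟨U, ?_⟩, h0⟩, fun l u hu => hsmul l u hu⟩, rfl⟩
  intro u v hu hv
  have := hsmul 2 _ (s3 u hu v hv (1 / 2))
  convert this using 1
  rw [smul_add, smul_smul, mul_one_div_cancel h2]
  module

theorem exists_submodule_of_line_cards {K L : Type*} [Field K] [Field L] [Algebra K L] [Fintype K]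
    [Fintype L] [DecidableEq L] (q n : ℕ) (hq : Fintype.card K = q) (hqodd : Odd q)
    (hn : Fintype.card L = q ^ n) (hn5 : 5 ≤ n)
    (U : Finset (L × L)) (hU : U.card = q ^ n) (h0 : (0, 0) ∈ U)
    (hlines : ∀ t : L, (∀ s : L, (U.filter fun v => v.1 - t * v.2 = s).card = 1) ∨
      (∀ s : L, (U.filter fun v => v.1 - t * v.2 = s).card ∈ ({0, q, q ^ (n - 2)} : Set ℕ)))
    (hhor : (U.filter fun v => v.2 = 0).card = q ^ (n - 2)) :
    ∃ M : Submodule K (L × L), (M : Set (L × L)) = U ∧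
      ∀ t : L, (U.filter fun v => v.1 - t * v.2 = 0).card ≤ q := by
  have hq1 : 1 < q := hq ▸ Fintype.one_lt_card
  have hdiv : Fintype.card K ∣ Fintype.card L := by
    rw [hq, hn]; exact dvd_pow_self _ (by omega)
  have hUL : U.card = Fintype.card L := by rw [hU, hn]
  have hd : DirDivisible (Fintype.card K) U := by
    intro t
    refine (hlines t).imp id fun h s => ?_
    rw [hq]
    rcases h s with h | h | h <;> rw [h]
    · exact dvd_zero _
    · exact dvd_pow_self _ (by omega)
  have hlt : q ^ 2 < q ^ (n - 2) := Nat.pow_lt_pow_right hq1 (by omega)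
  -- a line meeting `U` in `q ^ (n - 2)` points is horizontal
  have hlight : ∀ u ∈ U, ∀ t : L,
      (U.filter fun w => w.1 - t * w.2 = u.1 - t * u.2).card ≤ q := by
    intro u hu t
    rcases hlines t with h | h
    · rw [h]; omega
    rcases h (u.1 - t * u.2) with h' | h' | h'
    · omega
    · omega
    exfalso
    have h'' : (U.filter fun w => w.1 - t * w.2 = u.1 - t * u.2).card = q ^ (n - 2) := h'
    have hcount : U.card = (U.image fun w => w.1 - t * w.2).card * q ^ (n - 2) := by
      rw [Finset.card_eq_sum_card_image (fun w => w.1 - t * w.2) U, Finset.sum_const_nat]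
      intro s hs
      obtain ⟨v, hv, rfl⟩ := Finset.mem_image.1 hs
      rw [← h'', card_line_eq_card_line (K := K) U hUL hdiv hd t u v hu hv]
    have himg : (U.image fun w => w.1 - t * w.2).card = q ^ 2 := by
      have : q ^ n = q ^ 2 * q ^ (n - 2) := by rw [← pow_add]; congr 1; omega
      rw [hU, this] at hcount
      exact (Nat.eq_of_mul_eq_mul_right (by positivity) hcount).symm
    have hinj : (U.filter fun v => v.2 = 0).card ≤ (U.image fun w => w.1 - t * w.2).card := by
      refine Finset.card_le_card_of_injOn (fun w => w.1 - t * w.2) ?_ ?_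
      · intro w hw
        exact Finset.mem_coe.2 (Finset.mem_image_of_mem _ (Finset.mem_filter.1 hw).1)
      · intro w hw w' hw' hww
        have e1 := (Finset.mem_filter.1 hw).2
        have e2 := (Finset.mem_filter.1 hw').2
        simp only [e1, e2, mul_zero, sub_zero] at hww
        exact Prod.ext hww (e1.trans e2.symm)
    omega
  have hsub : ∀ u ∈ U, ∀ v ∈ U, u.2 ≠ v.2 → ∀ l : K, u + l • (v - u) ∈ U := by
    intro u hu v hv huv l
    have hne : v.2 - u.2 ≠ 0 := sub_ne_zero.2 (Ne.symm huv)
    set t := (v.1 - u.1) / (v.2 - u.2) with ht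
    have ht' : t * (v.2 - u.2) = v.1 - u.1 := div_mul_cancel₀ _ hne
    have hvl : v.1 - t * v.2 = u.1 - t * u.2 := by linear_combination -ht'
    have hge : 1 < (U.filter fun w => w.1 - t * w.2 = u.1 - t * u.2).card :=
      Finset.one_lt_card.2 ⟨u, Finset.mem_filter.2 ⟨hu, rfl⟩, v, Finset.mem_filter.2 ⟨hv, hvl⟩,
        fun h => huv (congrArg Prod.snd h)⟩
    have hle := hlight u hu t
    have hq2 : q < q ^ (n - 2) := lt_of_le_of_lt (Nat.le_self_pow two_ne_zero q) hlt
    have hZ : (U.filter fun w => w.1 - t * w.2 = u.1 - t * u.2).card = Fintype.card K := by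
      rw [hq]
      rcases hlines t with h | h
      · rw [h] at hge; omega
      · rcases h (u.1 - t * u.2) with h | h | h
        · omega
        · exact h
        · have : (U.filter fun w => w.1 - t * w.2 = u.1 - t * u.2).card = q ^ (n - 2) := h
          omega
    exact lineMap_mem_of_card_eq U hUL hdiv hd t u v hu hv hvl hZ l
  have h2 : (2 : K) ≠ 0 := by
    intro h
    have hchar : ringChar K = 2 := by
      have := ringChar.dvd (R := K) (x := 2) (by exact_mod_cast h)
      exact ((Nat.prime_dvd_prime_iff_eq (CharP.char_is_prime K _) Nat.prime_two).1 this)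
    have := FiniteField.even_card_iff_char_two.1 hchar
    rw [hq] at this
    exact (Nat.not_even_iff_odd.2 hqodd) (Nat.even_iff.2 this)
  obtain ⟨w, hw, hw2⟩ : ∃ w ∈ U, w.2 ≠ 0 := by
    by_contra! h
    have : U.filter (fun v => v.2 = 0) = U := Finset.filter_true_of_mem h
    rw [this, hU] at hhor
    have := Nat.pow_right_injective hq1 hhor
    omega
  obtain ⟨M, hM⟩ := exists_submodule_of_lineMap_mem h2 (U : Set (L × L)) h0 w hw hw2 hsub
  refine ⟨M, hM, fun t => ?_⟩
  simpa using hlight _ h0 t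

open Pointwise IntermediateField in
/-- The kernel of a functional `φ` and its intersection with the kernel of `x ↦ φ (b * x)`, described
through the largest `K(b)`-subspace contained in them. -/
theorem exists_ker_decomposition {K L : Type*} [Field K] [Field L] [Algebra K L]
    [FiniteDimensional K L] (φ : L →ₗ[K] K) (hφ : φ ≠ 0) (b : L)
    (hb : b ∉ (⊥ : IntermediateField K L)) :
    ∃ (m : ℕ) (c : L) (S : Submodule K⟮b⟯ L), c ≠ 0 ∧ Module.finrank K K⟮b⟯ = m + 2 ∧
      Module.finrank K L = (m + 2) * (Module.finrank K⟮b⟯ S + 1) ∧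
      (c • ((K⟮b⟯ : IntermediateField K L) : Set L)) ∩ (S : Set L) = {0} ∧
      (∀ x, φ x = 0 ↔ x ∈ S.restrictScalars K ⊔
          c • Submodule.span K (Set.range fun i : Fin (m + 1) => b ^ (i : ℕ))) ∧
      (∀ x, φ x = 0 ∧ φ (b * x) = 0 ↔ ∃ (y : Fin m → K) (s : L), s ∈ S ∧
          x = s + ∑ i : Fin m, algebraMap K L (y i) * (c * b ^ (i : ℕ))) := by
  have hbint : IsIntegral K b := IsIntegral.of_finite K b
  have ht1 : Module.finrank K K⟮b⟯ ≠ 1 := fun h =>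
    hb (IntermediateField.finrank_adjoin_simple_eq_one_iff.1 h)
  have ht0 : 0 < Module.finrank K K⟮b⟯ := Module.finrank_pos
  obtain ⟨m, hm⟩ : ∃ m, Module.finrank K K⟮b⟯ = m + 2 := ⟨Module.finrank K K⟮b⟯ - 2, by omega⟩
  let pb := IntermediateField.adjoin.powerBasis hbint
  have hdim : pb.dim = m + 2 := by rw [← hm, pb.finrank]
  let β : Module.Basis (Fin (m + 2)) K K⟮b⟯ := pb.basis.reindex (finCongr hdim)
  have hβ : ∀ i, ((β i : K⟮b⟯) : L) = b ^ (i : ℕ) := by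
    intro i
    simp [β, pb]
  let Ψ : L →ₗ[K] Module.Dual K K⟮b⟯ :=
    LinearMap.mk₂ K (fun x (f : K⟮b⟯) => φ ((f : L) * x))
      (fun x y f => by rw [mul_add, map_add])
      (fun r x f => by rw [mul_smul_comm, map_smul])
      (fun x f g => by rw [IntermediateField.coe_add, add_mul, map_add])
      (fun r x f => by rw [IntermediateField.coe_smul, smul_mul_assoc, map_smul])
  have hΨ : ∀ x f, Ψ x f = φ ((f : L) * x) := fun _ _ => rfl
  let S : Submodule K⟮b⟯ L :=
    { carrier := {x | ∀ f : K⟮b⟯, φ ((f : L) * x) = 0}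
      add_mem' := fun {x y} hx hy f => by rw [mul_add, map_add, hx f, hy f, add_zero]
      zero_mem' := fun f => by rw [mul_zero, map_zero]
      smul_mem' := fun g x hx f => by
        have := hx (f * g)
        rwa [IntermediateField.coe_mul, mul_assoc] at this }
  have hS : ∀ x, x ∈ S ↔ ∀ f : K⟮b⟯, φ ((f : L) * x) = 0 := fun _ => Iff.rfl
  have hker : S.restrictScalars K = LinearMap.ker Ψ := by
    ext x
    rw [LinearMap.mem_ker, Submodule.restrictScalars_mem, hS, LinearMap.ext_iff]
    rfl
  have hfS : Module.finrank K (LinearMap.ker Ψ) = (m + 2) * Module.finrank K⟮b⟯ S := by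
    rw [← hker, ← hm, Module.finrank_mul_finrank]
    rfl
  have hfL : Module.finrank K L = (m + 2) * Module.finrank K⟮b⟯ L := by
    rw [← hm, Module.finrank_mul_finrank]
  have hdual : Module.finrank K (Module.Dual K K⟮b⟯) = m + 2 := by
    rw [Subspace.dual_finrank_eq, hm]
  have hrk := LinearMap.finrank_range_add_finrank_ker Ψ
  have hrle : Module.finrank K (LinearMap.range Ψ) ≤ m + 2 := hdual ▸ Submodule.finrank_le _
  have hSlt : Module.finrank K⟮b⟯ S < Module.finrank K⟮b⟯ L := by
    refine Submodule.finrank_lt fun h => hφ (LinearMap.ext fun x => ?_)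
    have : x ∈ S := h ▸ Submodule.mem_top
    simpa using (hS x).1 this 1
  have hLle : Module.finrank K⟮b⟯ L ≤ Module.finrank K⟮b⟯ S + 1 := by
    rw [hfS, hfL] at hrk
    by_contra! hcon
    have : (m + 2) * (Module.finrank K⟮b⟯ S + 2) ≤ (m + 2) * Module.finrank K⟮b⟯ L :=
      Nat.mul_le_mul_left _ hcon
    nlinarith
  have hLeq : Module.finrank K⟮b⟯ L = Module.finrank K⟮b⟯ S + 1 := by omega
  have hsurj : Function.Surjective Ψ := by
    rw [← LinearMap.range_eq_top]
    refine Submodule.eq_top_of_finrank_eq ?_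
    rw [hfS, hfL, hLeq, mul_add] at hrk
    rw [hdual]; omega
  obtain ⟨c, hc⟩ := hsurj (β.constr K fun i => if (i : ℕ) = m + 1 then (1 : K) else 0)
  have hcb : ∀ i, i ≤ m + 1 → φ (b ^ i * c) = if i = m + 1 then (1 : K) else 0 := by
    intro i hi
    have := congrArg (fun g => g (β ⟨i, by omega⟩)) hc
    simp only [Module.Basis.constr_basis, hΨ, hβ] at this
    exact this
  have hcS : ∀ f : K⟮b⟯, (f : L) * c ∈ S → f = 0 := by
    intro f hf
    by_contra hf0
    have h1 := (hS _).1 hf (β ⟨m + 1, by omega⟩ * f⁻¹)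
    rw [IntermediateField.coe_mul, mul_assoc, ← mul_assoc ((f⁻¹ : K⟮b⟯) : L),
      ← IntermediateField.coe_mul, inv_mul_cancel₀ hf0, IntermediateField.coe_one, one_mul, hβ,
      hcb _ le_rfl, if_pos rfl] at h1
    exact one_ne_zero h1
  have hc0 : c ≠ 0 := by
    rintro rfl
    refine one_ne_zero (hcS 1 ?_)
    rw [mul_zero]; exact S.zero_mem
  have hdec : ∀ x : L, ∃ (y : Fin (m + 2) → K) (s : L), s ∈ S ∧
      x = s + ∑ i : Fin (m + 2), algebraMap K L (y i) * (c * b ^ (i : ℕ)) := by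
    intro x
    let Θ : K⟮b⟯ →ₗ[K] Module.Dual K K⟮b⟯ :=
      Ψ ∘ₗ (LinearMap.mulRight K c ∘ₗ (K⟮b⟯).val.toLinearMap)
    have hΘ : ∀ f, Θ f = Ψ ((f : L) * c) := fun _ => rfl
    have hinj : Function.Injective Θ := by
      rw [injective_iff_map_eq_zero]
      intro f hf
      refine hcS f ?_
      rw [← Submodule.restrictScalars_mem K, hker, LinearMap.mem_ker, ← hΘ, hf]
    have hΘs : Function.Surjective Θ :=
      (LinearMap.injective_iff_surjective_of_finrank_eq_finrank (by rw [hdual, hm])).1 hinj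
    obtain ⟨f, hf⟩ := hΘs (Ψ x)
    refine ⟨fun i => β.repr f i, x - (f : L) * c, ?_, ?_⟩
    · rw [← Submodule.restrictScalars_mem K, hker, LinearMap.mem_ker, map_sub, ← hΘ, hf, sub_self]
    · have : (f : L) = ∑ i : Fin (m + 2), algebraMap K L (β.repr f i) * b ^ (i : ℕ) := by
        conv_lhs => rw [← β.sum_repr f]
        rw [IntermediateField.coe_sum]
        refine Finset.sum_congr rfl fun i _ => ?_
        rw [IntermediateField.coe_smul, hβ, Algebra.smul_def]
      rw [sub_add_eq_add_sub, eq_sub_iff_add_eq, this, Finset.sum_mul]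
      congr 1
      refine Finset.sum_congr rfl fun i _ => ?_
      ring
  have hφS : ∀ s ∈ S, φ s = 0 := fun s hs => by simpa using (hS s).1 hs 1
  have hφbS : ∀ s ∈ S, φ (b * s) = 0 := fun s hs => by
    simpa using (hS s).1 hs (IntermediateField.AdjoinSimple.gen K b)
  have hφk : ∀ (k : K) (x : L), φ (algebraMap K L k * x) = k * φ x := fun k x => by
    rw [← Algebra.smul_def, map_smul, smul_eq_mul]
  have hcb0 : ∀ i, i < m + 1 → φ (c * b ^ i) = 0 := fun i hi => by
    rw [mul_comm, hcb i (by omega), if_neg (by omega)]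
  have hcb1 : φ (c * b ^ (m + 1)) = 1 := by rw [mul_comm, hcb _ le_rfl, if_pos rfl]
  have hlast : ∀ (y : Fin (m + 2) → K) (s : L), s ∈ S →
      φ (s + ∑ i : Fin (m + 2), algebraMap K L (y i) * (c * b ^ (i : ℕ))) = 0 →
      y (Fin.last _) = 0 := by
    intro y s hs hx
    rw [map_add, hφS s hs, zero_add, map_sum, Fin.sum_univ_castSucc, Finset.sum_eq_zero] at hx
    · rw [zero_add, hφk, Fin.val_last, hcb1, mul_one] at hx
      exact hx
    · intro i _
      rw [hφk, Fin.val_castSucc, hcb0 i i.2, mul_zero]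
  have hmul : ∀ (k : K) (i : ℕ), b * (algebraMap K L k * (c * b ^ i)) =
      algebraMap K L k * (c * b ^ (i + 1)) := fun k i => by ring
  have hspan : ∀ z ∈ Submodule.span K (Set.range fun i : Fin (m + 1) => b ^ (i : ℕ)),
      φ (c * z) = 0 := by
    intro z hz
    induction hz using Submodule.span_induction with
    | mem z hz =>
      obtain ⟨i, rfl⟩ := hz
      exact hcb0 i i.2
    | zero => simp
    | add u v _ _ hu hv => rw [mul_add, map_add, hu, hv, add_zero]
    | smul k u _ hu => rw [mul_smul_comm, map_smul, hu, smul_zero]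
  refine ⟨m, c, S, hc0, hm, by rw [hfL, hLeq], ?_, ?_, ?_⟩
  · ext x
    simp only [Set.mem_inter_iff, Set.mem_singleton_iff, SetLike.mem_coe]
    constructor
    · rintro ⟨⟨f, hf, rfl⟩, hx⟩
      have := hcS ⟨f, hf⟩ (by simpa [mul_comm] using hx)
      have hf0 : f = 0 := congrArg Subtype.val this
      simp [hf0]
    · rintro rfl
      exact ⟨⟨0, (K⟮b⟯).zero_mem, by simp⟩, S.zero_mem⟩
  · intro x
    constructor
    · intro hx
      obtain ⟨y, s, hs, rfl⟩ := hdec x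
      have hy := hlast y s hs hx
      refine Submodule.add_mem_sup hs (Submodule.mem_smul_pointwise_iff_exists _ _ _ |>.2
        ⟨∑ i : Fin (m + 1), y i.castSucc • b ^ (i : ℕ), ?_, ?_⟩)
      · exact Submodule.sum_mem _ fun i _ => Submodule.smul_mem _ _ (Submodule.subset_span ⟨i, rfl⟩)
      · rw [Fin.sum_univ_castSucc (n := m + 1), hy, map_zero, zero_mul, add_zero, smul_eq_mul,
          Finset.mul_sum]
        refine Finset.sum_congr rfl fun i _ => ?_
        rw [Algebra.smul_def, Fin.val_castSucc]; ring
    · intro hx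
      obtain ⟨s, hs, z, hz, rfl⟩ := Submodule.mem_sup.1 hx
      obtain ⟨z', hz', rfl⟩ := (Submodule.mem_smul_pointwise_iff_exists _ _ _).1 hz
      rw [map_add, hφS s hs, zero_add]
      exact hspan z' hz'
  · intro x
    constructor
    · rintro ⟨hx, hbx⟩
      obtain ⟨y, s, hs, rfl⟩ := hdec x
      have hy := hlast y s hs hx
      rw [Fin.sum_univ_castSucc, hy, map_zero, zero_mul, add_zero] at hbx ⊢
      have hy' : y (Fin.last m).castSucc = 0 := by
        rw [mul_add, map_add, hφbS s hs, zero_add, Finset.mul_sum, map_sum, Fin.sum_univ_castSucc,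
          Finset.sum_eq_zero] at hbx
        · rw [zero_add, hmul, hφk, Fin.val_castSucc, Fin.val_last, hcb1, mul_one] at hbx
          exact hbx
        · intro i _
          rw [hmul, hφk, Fin.val_castSucc, Fin.val_castSucc, hcb0 _ (by omega), mul_zero]
      refine ⟨fun i => y i.castSucc.castSucc, s, hs, ?_⟩
      rw [Fin.sum_univ_castSucc, hy', map_zero, zero_mul, add_zero]
      rfl
    · rintro ⟨y, s, hs, rfl⟩
      rw [mul_add, map_add, map_add, hφS s hs, hφbS s hs, zero_add, zero_add, Finset.mul_sum,
        map_sum, map_sum]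
      constructor
      · refine Finset.sum_eq_zero fun i _ => ?_
        rw [hφk, hcb0 _ (by omega), mul_zero]
      · refine Finset.sum_eq_zero fun i _ => ?_
        rw [hmul, hφk, hcb0 _ (by omega), mul_zero]

/-- If `b` is not in `K`, a nonzero functional `φ` and `x ↦ φ (b * x)` are independent. -/
theorem finrank_ker_prod_mul {K L : Type*} [Field K] [Field L] [Algebra K L]
    [FiniteDimensional K L] (φ : L →ₗ[K] K) (hφ : φ ≠ 0) (b : L)
    (hb : b ∉ (⊥ : IntermediateField K L)) :
    Module.finrank K (LinearMap.ker (φ.prod (φ ∘ₗ LinearMap.mulLeft K b))) + 2 =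
      Module.finrank K L := by
  have htop : LinearMap.range (φ.prod (φ ∘ₗ LinearMap.mulLeft K b)) = ⊤ := by
    by_contra hne
    obtain ⟨f, hf0, hf⟩ := Submodule.exists_le_ker_of_lt_top _ (lt_top_iff_ne_top.2 hne)
    have hfe : ∀ p : K × K, f p = p.1 * f (1, 0) + p.2 * f (0, 1) := by
      intro p
      rw [← smul_eq_mul, ← smul_eq_mul, ← map_smul, ← map_smul, ← map_add]
      congr 1
      ext <;> simp
    have hz : ∀ x : L, φ ((algebraMap K L (f (1, 0)) + algebraMap K L (f (0, 1)) * b) * x) = 0 := by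
      intro x
      have h := hf ⟨x, rfl⟩
      rw [LinearMap.mem_ker, hfe] at h
      rw [add_mul, map_add, mul_assoc, ← Algebra.smul_def, ← Algebra.smul_def, map_smul, map_smul,
        smul_eq_mul, smul_eq_mul, mul_comm, mul_comm (f (0, 1))]
      exact h
    have hne : algebraMap K L (f (1, 0)) + algebraMap K L (f (0, 1)) * b ≠ 0 := by
      intro h
      by_cases h1 : f (0, 1) = 0
      · rw [h1, map_zero, zero_mul, add_zero] at h
        have h0 : f (1, 0) = 0 := (algebraMap K L).injective (h.trans (map_zero _).symm)
        exact hf0 (LinearMap.ext fun p => by rw [hfe, h0, h1]; simp)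
      · refine hb (IntermediateField.mem_bot.2 ⟨-f (1, 0) / f (0, 1), ?_⟩)
        have h1' : algebraMap K L (f (0, 1)) ≠ 0 := by simpa using h1
        rw [map_div₀, map_neg, div_eq_iff h1']
        linear_combination -h
    refine hφ (LinearMap.ext fun x => ?_)
    have := hz ((algebraMap K L (f (1, 0)) + algebraMap K L (f (0, 1)) * b)⁻¹ * x)
    rwa [mul_inv_cancel_left₀ hne] at this
  have := LinearMap.finrank_range_add_finrank_ker (φ.prod (φ ∘ₗ LinearMap.mulLeft K b))
  rw [htop, finrank_top, Module.finrank_prod, Module.finrank_self] at this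
  omega

open Pointwise IntermediateField in
theorem exists_standard_form {K L : Type*} [Field K] [Field L] [Algebra K L] [Fintype K]
    [Fintype L] (q n : ℕ) (hq : Fintype.card K = q)
    (hn : Module.finrank K L = n) (hn2 : 2 ≤ n) (M : Submodule K (L × L))
    (hM : Nat.card M = q ^ n) (hW : Nat.card (M.comap (LinearMap.inl K L L)) = q ^ (n - 2))
    (h10 : ((1, 0) : L × L) ∈ M) (h01 : ((0, 1) : L × L) ∈ M)
    (hwt : ∀ t : L, {v : L × L | v ∈ M ∧ v.1 - t * v.2 = 0}.ncard ≤ q) :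
    ∃ (m : ℕ) (a b c : L) (S : Submodule K⟮b⟯ L), a ≠ 0 ∧ b ≠ 0 ∧ c ≠ 0 ∧
      Module.finrank K K⟮b⟯ = m + 2 ∧ n = (m + 2) * (Module.finrank K⟮b⟯ S + 1) ∧
      (c • ((K⟮b⟯ : IntermediateField K L) : Set L)) ∩ (S : Set L) = {0} ∧
      (1 : L) ∈ S.restrictScalars K ⊔
          c • Submodule.span K (Set.range fun i : Fin (m + 1) => b ^ (i : ℕ)) ∧
      a ∉ S.restrictScalars K ⊔
          c • Submodule.span K (Set.range fun i : Fin (m + 1) => b ^ (i : ℕ)) ∧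
      ∀ u : L × L, u ∈ M ↔ ∃ (x : Fin m → K) (α β : K) (s : L), s ∈ S ∧
        u = (s + (∑ i : Fin m, algebraMap K L (x i) * (c * b ^ (i : ℕ))) +
              algebraMap K L α + algebraMap K L β * a,
            algebraMap K L α + algebraMap K L β * b) := by
  have hq1 : 1 < q := hq ▸ Fintype.one_lt_card
  have hKq : Nat.card K = q := by rw [Nat.card_eq_fintype_card, hq]
  set W := M.comap (LinearMap.inl K L L) with hWdef
  have hWm : ∀ x, x ∈ W ↔ (x, (0 : L)) ∈ M := fun x => Iff.rfl
  have h1W : (1 : L) ∈ W := h10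
  have hpow : q ^ n = q ^ (n - 2) * q * q := by
    rw [mul_assoc, ← sq, ← pow_add]; congr 1; omega
  obtain ⟨⟨a, b⟩, hab, hb⟩ : ∃ u ∈ M, u.2 ∉ (⊥ : IntermediateField K L) := by
    by_contra! hcon
    let f : W × K → L × L := fun p => ((p.1 : L), algebraMap K L p.2)
    have hsub : (M : Set (L × L)) ⊆ Set.range f := by
      intro u hu
      obtain ⟨k, hk⟩ := IntermediateField.mem_bot.1 (hcon u hu)
      have hu1 : u.1 ∈ W := by
        rw [hWm]
        have := M.sub_mem hu (M.smul_mem k h01)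
        convert this using 1
        ext
        · simp
        · simp [hk, Algebra.smul_def]
      exact ⟨(⟨u.1, hu1⟩, k), Prod.ext rfl hk⟩
    have h1 : Nat.card M ≤ Nat.card (W × K) :=
      (Nat.card_mono (Set.toFinite _) hsub).trans (Finite.card_range_le f)
    rw [Nat.card_prod, hM, hW, hKq, hpow] at h1
    have : 0 < q ^ (n - 2) * q := by positivity
    nlinarith
  have hindep : ∀ α β : K, algebraMap K L α + algebraMap K L β * b = 0 → α = 0 ∧ β = 0 := by
    intro α β h
    by_cases hβ : β = 0
    · subst hβ
      rw [map_zero, zero_mul, add_zero] at h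
      exact ⟨(algebraMap K L).injective (h.trans (map_zero _).symm), rfl⟩
    · exfalso
      refine hb (IntermediateField.mem_bot.2 ⟨-α / β, ?_⟩)
      have h1' : algebraMap K L β ≠ 0 := by simpa using hβ
      rw [map_div₀, map_neg, div_eq_iff h1']
      linear_combination -h
  have hspan : ∀ u : L × L, u ∈ M ↔ ∃ w ∈ W, ∃ α β : K,
      u = (w + algebraMap K L α + algebraMap K L β * a,
        algebraMap K L α + algebraMap K L β * b) := by
    have hmem : ∀ w ∈ W, ∀ α β : K, ((w + algebraMap K L α + algebraMap K L β * a,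
        algebraMap K L α + algebraMap K L β * b) : L × L) ∈ M := by
      intro w hw α β
      have := M.add_mem (M.add_mem (M.add_mem ((hWm w).1 hw) (M.smul_mem α h10))
        (M.smul_mem α h01)) (M.smul_mem β hab)
      convert this using 1
      ext <;> simp [Algebra.smul_def]
    let f : W × K × K → M := fun p => ⟨_, hmem p.1 p.1.2 p.2.1 p.2.2⟩
    have hf : Function.Injective f := by
      rintro ⟨w, α, β⟩ ⟨w', α', β'⟩ h
      obtain ⟨h1, h2⟩ := Prod.mk.inj (congrArg Subtype.val h)
      obtain ⟨h3, h4⟩ := hindep (α - α') (β - β') (by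
        rw [map_sub, map_sub]; linear_combination h2)
      obtain rfl := sub_eq_zero.1 h3
      obtain rfl := sub_eq_zero.1 h4
      have : w = w' := Subtype.ext (by linear_combination h1)
      rw [this]
    have hbij : Function.Bijective f := by
      rw [Nat.bijective_iff_injective_and_card]
      refine ⟨hf, ?_⟩
      rw [Nat.card_prod, Nat.card_prod, hM, hW, hKq, hpow, mul_assoc]
    intro u
    constructor
    · intro hu
      obtain ⟨p, hp⟩ := hbij.2 ⟨u, hu⟩
      exact ⟨p.1, p.1.2, p.2.1, p.2.2, (congrArg Subtype.val hp).symm⟩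
    · rintro ⟨w, hw, α, β, rfl⟩
      exact hmem w hw α β
  have haH : a ∉ W ⊔ W.map (LinearMap.mulLeft K b) := by
    intro ha
    obtain ⟨w, hw, z, ⟨w', hw', rfl⟩, hwz⟩ := Submodule.mem_sup.1 ha
    rw [LinearMap.mulLeft_apply] at hwz
    have hmem : ∀ α β : K, (w' * (algebraMap K L α + algebraMap K L β * b),
        algebraMap K L α + algebraMap K L β * b) ∈ M := by
      intro α β
      refine (hspan _).2 ⟨α • w' - β • w - α • (1 : L),
        W.sub_mem (W.sub_mem (W.smul_mem _ hw') (W.smul_mem _ hw)) (W.smul_mem _ h1W), α, β, ?_⟩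
      rw [Prod.mk.injEq]
      refine ⟨?_, rfl⟩
      rw [← hwz]
      simp only [Algebra.smul_def]
      ring
    let f : K × K → L × L := fun p => (w' * (algebraMap K L p.1 + algebraMap K L p.2 * b),
        algebraMap K L p.1 + algebraMap K L p.2 * b)
    have hf : Function.Injective f := by
      rintro ⟨α, β⟩ ⟨α', β'⟩ h
      have h2 := congrArg Prod.snd h
      dsimp only [f] at h2
      obtain ⟨h3, h4⟩ := hindep (α - α') (β - β') (by
        rw [map_sub, map_sub]; linear_combination h2)
      rw [sub_eq_zero.1 h3, sub_eq_zero.1 h4]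
    have hcard : (Set.range f).ncard = q * q := by
      rw [← Nat.card_coe_set_eq, Nat.card_range_of_injective hf, Nat.card_prod, hKq]
    have hle : (Set.range f).ncard ≤ {v : L × L | v ∈ M ∧ v.1 - w' * v.2 = 0}.ncard := by
      refine Set.ncard_le_ncard ?_ (Set.toFinite _)
      rintro _ ⟨p, rfl⟩
      exact ⟨hmem _ _, sub_self _⟩
    have := hwt w'
    nlinarith
  obtain ⟨φ, hφa, hφ⟩ := Submodule.exists_le_ker_of_notMem haH
  have hφ0 : φ ≠ 0 := by rintro rfl; exact hφa rfl
  have hWφ : ∀ x, x ∈ W ↔ φ x = 0 ∧ φ (b * x) = 0 := by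
    have hle : W ≤ LinearMap.ker (φ.prod (φ ∘ₗ LinearMap.mulLeft K b)) := by
      intro x hx
      rw [LinearMap.mem_ker]
      exact Prod.ext (hφ (Submodule.mem_sup_left hx))
        (hφ (Submodule.mem_sup_right ⟨x, hx, rfl⟩))
    have hWf : Module.finrank K W = n - 2 := by
      have := Module.natCard_eq_pow_finrank (K := K) (V := W)
      rw [hW, hKq] at this
      exact (Nat.pow_right_injective hq1 this).symm
    have heq := Submodule.eq_of_le_of_finrank_eq hle (by
      have := finrank_ker_prod_mul φ hφ0 b hb
      omega)
    intro x
    rw [heq, LinearMap.mem_ker]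
    exact Prod.ext_iff
  obtain ⟨m, c, S, hc0, hm, hnm, hcS, hker, hker2⟩ := exists_ker_decomposition φ hφ0 b hb
  refine ⟨m, a, b, c, S, ?_, ?_, hc0, hm, hn ▸ hnm, hcS, (hker 1).1 ((hWφ 1).1 h1W).1,
    fun h => hφa ((hker a).2 h), ?_⟩
  · rintro rfl; exact hφa (map_zero _)
  · rintro rfl; exact hb (zero_mem _)
  · intro u
    rw [hspan]
    constructor
    · rintro ⟨w, hw, α, β, rfl⟩
      obtain ⟨x, s, hs, rfl⟩ := (hker2 w).1 ((hWφ w).1 hw)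
      exact ⟨x, α, β, s, hs, rfl⟩
    · rintro ⟨x, α, β, s, hs, rfl⟩
      exact ⟨_, (hWφ _).2 ((hker2 _).2 ⟨x, s, hs, rfl⟩), α, β, rfl⟩

section AffinePart

variable {L : Type*} [Field L]

/-- The line of `PG(2,L)` at which the third coordinate vanishes. -/
def lineAtInfinity (L : Type*) [Field L] : Submodule L (L × L × L) :=
  LinearMap.ker (LinearMap.snd L L L ∘ₗ LinearMap.snd L L (L × L))

theorem mem_lineAtInfinity {v : L × L × L} : v ∈ lineAtInfinity L ↔ v.2.2 = 0 := Iff.rfl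

/-- The affine points of a set of points of `PG(2,L)`. -/
def affinePart (B : Set (Submodule L (L × L × L))) : Set (L × L) :=
  {u | Submodule.span L {((u.1, u.2, 1) : L × L × L)} ∈ B}

theorem span_affine_injective :
    Function.Injective fun u : L × L => Submodule.span L {((u.1, u.2, 1) : L × L × L)} := by
  rintro ⟨x, y⟩ ⟨x', y'⟩ h
  have h1 : ((x, y, 1) : L × L × L) ∈ Submodule.span L {((x', y', 1) : L × L × L)} := by
    rw [← show _ = Submodule.span L {((x', y', 1) : L × L × L)} from h]
    exact Submodule.mem_span_singleton_self _
  obtain ⟨r, hr⟩ := Submodule.mem_span_singleton.1 h1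
  simp only [Prod.smul_mk, smul_eq_mul, mul_one, Prod.mk.injEq] at hr
  obtain ⟨h2, h3, rfl⟩ := hr
  simp [← h2, ← h3]

theorem span_eq_span_affine {v : L × L × L} (hv : v.2.2 ≠ 0) :
    Submodule.span L {v} = Submodule.span L {((v.1 / v.2.2, v.2.1 / v.2.2, 1) : L × L × L)} := by
  have : v = v.2.2 • ((v.1 / v.2.2, v.2.1 / v.2.2, 1) : L × L × L) := by
    ext <;> simp [mul_div_cancel₀ _ hv]
  conv_lhs => rw [this]
  exact Submodule.span_singleton_smul_eq (IsUnit.mk0 _ hv) _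

theorem ncard_points_le [Finite L] {B : Set (Submodule L (L × L × L))}
    (hB : ∀ P ∈ B, ∃ v : L × L × L, v ≠ 0 ∧ P = Submodule.span L {v})
    (s : Submodule L (L × L × L)) :
    {P | P ∈ B ∧ P ≤ s}.ncard = {u | u ∈ affinePart B ∧ ((u.1, u.2, 1) : L × L × L) ∈ s}.ncard +
      {P | P ∈ B ∧ P ≤ s ∧ P ≤ lineAtInfinity L}.ncard := by
  have himg : {P | P ∈ B ∧ P ≤ s} = (fun u : L × L =>
      Submodule.span L {((u.1, u.2, 1) : L × L × L)}) ''
        {u | u ∈ affinePart B ∧ ((u.1, u.2, 1) : L × L × L) ∈ s} ∪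
      {P | P ∈ B ∧ P ≤ s ∧ P ≤ lineAtInfinity L} := by
    ext P
    constructor
    · rintro ⟨hP, hPs⟩
      obtain ⟨v, hv0, rfl⟩ := hB P hP
      by_cases hv : v.2.2 = 0
      · right
        refine ⟨hP, hPs, ?_⟩
        rwa [Submodule.span_singleton_le_iff_mem, mem_lineAtInfinity]
      · left
        rw [span_eq_span_affine hv] at hP hPs ⊢
        exact ⟨(v.1 / v.2.2, v.2.1 / v.2.2), ⟨hP, (Submodule.span_singleton_le_iff_mem _ _).1 hPs⟩,
          rfl⟩
    · rintro (⟨u, ⟨hu, hus⟩, rfl⟩ | ⟨hP, hPs, -⟩)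
      · exact ⟨hu, (Submodule.span_singleton_le_iff_mem _ _).2 hus⟩
      · exact ⟨hP, hPs⟩
  rw [himg, Set.ncard_union_eq _ (Set.toFinite _) (Set.toFinite _),
    Set.ncard_image_of_injective _ span_affine_injective]
  rw [Set.disjoint_left]
  rintro _ ⟨u, -, rfl⟩ ⟨-, -, h⟩
  rw [Submodule.span_singleton_le_iff_mem, mem_lineAtInfinity] at h
  exact one_ne_zero h

theorem span_eq_span_of_mem {w v : L × L × L} (hv : v ≠ 0) (h : v ∈ Submodule.span L {w}) :
    Submodule.span L {v} = Submodule.span L {w} := by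
  obtain ⟨r, rfl⟩ := Submodule.mem_span_singleton.1 h
  refine Submodule.span_singleton_smul_eq (IsUnit.mk0 _ ?_) _
  rintro rfl
  exact hv (zero_smul _ _)

open Classical in
theorem ncard_points_le_of_inf_eq_span [Finite L] {B : Set (Submodule L (L × L × L))}
    (hB : ∀ P ∈ B, ∃ v : L × L × L, v ≠ 0 ∧ P = Submodule.span L {v})
    (s : Submodule L (L × L × L)) (w : L × L × L)
    (hw : s ⊓ lineAtInfinity L = Submodule.span L {w}) :
    {P | P ∈ B ∧ P ≤ s}.ncard = {u | u ∈ affinePart B ∧ ((u.1, u.2, 1) : L × L × L) ∈ s}.ncard +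
      if Submodule.span L {w} ∈ B then 1 else 0 := by
  rw [ncard_points_le hB]
  congr 1
  have h1 : {P | P ∈ B ∧ P ≤ s ∧ P ≤ lineAtInfinity L} = {P | P ∈ B ∧ P = Submodule.span L {w}} := by
    ext P
    simp only [Set.mem_ofPred_eq, and_congr_right_iff]
    intro hP
    rw [← le_inf_iff, hw]
    constructor
    · intro h
      obtain ⟨v, hv, rfl⟩ := hB P hP
      exact span_eq_span_of_mem hv ((Submodule.span_singleton_le_iff_mem _ _).1 h)
    · exact fun h => h.le
  rw [h1]
  split_ifs with h
  · rw [Set.ncard_eq_one]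
    refine ⟨Submodule.span L {w}, ?_⟩
    ext P
    simp only [Set.mem_ofPred_eq, Set.mem_singleton_iff]
    exact ⟨fun h => h.2, fun hP => ⟨hP ▸ h, hP⟩⟩
  · rw [Set.ncard_eq_zero]
    ext P
    simp only [Set.mem_ofPred_eq, Set.mem_empty_iff_false, iff_false]
    rintro ⟨hP, rfl⟩
    exact h hP

theorem finrank_ker_functional (g : L × L × L →ₗ[L] L) (hg : g ≠ 0) :
    Module.finrank L (LinearMap.ker g) = 2 := by
  have h := Module.Dual.finrank_ker_add_one_of_ne_zero (f := g) hg
  have h3 : Module.finrank L (L × L × L) = 3 := by simp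
  omega

/-- The line `x = t * y + s * z`. -/
def obliqueLine (t s : L) : Submodule L (L × L × L) :=
  LinearMap.ker (LinearMap.fst L L (L × L) - t • (LinearMap.fst L L L ∘ₗ LinearMap.snd L L (L × L)) -
    s • (LinearMap.snd L L L ∘ₗ LinearMap.snd L L (L × L)))

/-- The line `y = s * z`. -/
def horizontalLine (s : L) : Submodule L (L × L × L) :=
  LinearMap.ker (LinearMap.fst L L L ∘ₗ LinearMap.snd L L (L × L) -
    s • (LinearMap.snd L L L ∘ₗ LinearMap.snd L L (L × L)))

theorem mem_obliqueLine {t s : L} {v : L × L × L} :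
    v ∈ obliqueLine t s ↔ v.1 - t * v.2.1 - s * v.2.2 = 0 := Iff.rfl

theorem mem_horizontalLine {s : L} {v : L × L × L} :
    v ∈ horizontalLine s ↔ v.2.1 - s * v.2.2 = 0 := Iff.rfl

theorem finrank_obliqueLine (t s : L) : Module.finrank L (obliqueLine t s) = 2 := by
  refine finrank_ker_functional _ fun h => ?_
  have := LinearMap.congr_fun h (1, 0, 0)
  simp at this

theorem finrank_horizontalLine (s : L) : Module.finrank L (horizontalLine s) = 2 := by
  refine finrank_ker_functional _ fun h => ?_
  have := LinearMap.congr_fun h (0, 1, 0)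
  simp at this

theorem obliqueLine_ne (t s : L) : obliqueLine t s ≠ lineAtInfinity L := by
  intro h
  have h1 : ((1, 0, 0) : L × L × L) ∈ obliqueLine t s := by rw [h, mem_lineAtInfinity]
  simp [mem_obliqueLine] at h1

theorem obliqueLine_inf (t s : L) :
    obliqueLine t s ⊓ lineAtInfinity L = Submodule.span L {(t, 1, 0)} := by
  ext ⟨x, y, z⟩
  simp only [Submodule.mem_inf, mem_obliqueLine, mem_lineAtInfinity, Submodule.mem_span_singleton,
    Prod.smul_mk, smul_eq_mul, mul_one, mul_zero, Prod.mk.injEq]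
  constructor
  · rintro ⟨h, rfl⟩
    exact ⟨y, by linear_combination -h, rfl, rfl⟩
  · rintro ⟨r, rfl, rfl, rfl⟩
    exact ⟨by ring, rfl⟩

theorem horizontalLine_inf (s : L) :
    horizontalLine s ⊓ lineAtInfinity L = Submodule.span L {(1, 0, 0)} := by
  ext ⟨x, y, z⟩
  simp only [Submodule.mem_inf, mem_horizontalLine, mem_lineAtInfinity, Submodule.mem_span_singleton,
    Prod.smul_mk, smul_eq_mul, mul_one, mul_zero, Prod.mk.injEq]
  constructor
  · rintro ⟨h, rfl⟩
    exact ⟨x, rfl, by linear_combination -h, rfl⟩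
  · rintro ⟨r, rfl, rfl, rfl⟩
    exact ⟨by ring, rfl⟩

open Classical in
theorem ncard_points_le_obliqueLine [Finite L] {B : Set (Submodule L (L × L × L))}
    (hB : ∀ P ∈ B, ∃ v : L × L × L, v ≠ 0 ∧ P = Submodule.span L {v}) (t s : L) :
    {P | P ∈ B ∧ P ≤ obliqueLine t s}.ncard = {u | u ∈ affinePart B ∧ u.1 - t * u.2 = s}.ncard +
      if Submodule.span L {((t, 1, 0) : L × L × L)} ∈ B then 1 else 0 := by
  rw [ncard_points_le_of_inf_eq_span hB _ _ (obliqueLine_inf t s)]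
  simp only [mem_obliqueLine, mul_one, sub_eq_zero]

open Classical in
theorem ncard_points_le_horizontalLine [Finite L] {B : Set (Submodule L (L × L × L))}
    (hB : ∀ P ∈ B, ∃ v : L × L × L, v ≠ 0 ∧ P = Submodule.span L {v}) (s : L) :
    {P | P ∈ B ∧ P ≤ horizontalLine s}.ncard = {u | u ∈ affinePart B ∧ u.2 = s}.ncard +
      if Submodule.span L {((1, 0, 0) : L × L × L)} ∈ B then 1 else 0 := by
  rw [ncard_points_le_of_inf_eq_span hB _ _ (horizontalLine_inf s)]
  simp only [mem_horizontalLine, mul_one, sub_eq_zero]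

theorem ncard_affinePart [Finite L] {B : Set (Submodule L (L × L × L))}
    (hB : ∀ P ∈ B, ∃ v : L × L × L, v ≠ 0 ∧ P = Submodule.span L {v}) :
    B.ncard = (affinePart B).ncard + {P | P ∈ B ∧ P ≤ lineAtInfinity L}.ncard := by
  have := ncard_points_le hB ⊤
  simpa using this

end AffinePart

/-- A map on a finite set all of whose fibres are nonempty has one-point fibres if the target is not
smaller than the set. -/
theorem ncard_fiber_eq_one {α β : Type*} [Finite α] [Finite β] (U : Set α) (f : α → β)
    (hU : U.ncard = Nat.card β) (hf : ∀ b, {a | a ∈ U ∧ f a = b}.ncard ≠ 0) (b : β) :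
    {a | a ∈ U ∧ f a = b}.ncard = 1 := by
  have hsurj : Function.Surjective (fun a : U => f a) := by
    intro b
    obtain ⟨a, ha, hab⟩ := Set.nonempty_of_ncard_ne_zero (hf b)
    exact ⟨⟨a, ha⟩, hab⟩
  have hbij : Function.Bijective (fun a : U => f a) := by
    rw [Nat.bijective_iff_surjective_and_card]
    exact ⟨hsurj, by rw [Nat.card_coe_set_eq, hU]⟩
  obtain ⟨a, ha⟩ := hsurj b
  rw [Set.ncard_eq_one]
  refine ⟨a, ?_⟩
  ext x
  constructor
  · rintro ⟨hx, hxb⟩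
    exact congrArg Subtype.val (hbij.1 (a₁ := ⟨x, hx⟩) (hxb.trans ha.symm))
  · rintro rfl
    exact ⟨a.2, ha⟩

open Pointwise IntermediateField in
/-- The classification for sets containing three fixed affine points, with the line `y = 0` heavy. -/
theorem exists_coordinates_of_normalized {K L : Type*} [Field K] [Field L] [Algebra K L]
    [Fintype K] [Fintype L] (q n : ℕ) (hq : Fintype.card K = q) (hqodd : Odd q)
    (hn : Module.finrank K L = n) (hn5 : 5 ≤ n) (B : Set (Submodule L (L × L × L)))
    (hBpts : ∀ P ∈ B, ∃ v : L × L × L, v ≠ 0 ∧ P = Submodule.span L {v})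
    (hblock : ∀ s : Submodule L (L × L × L), Module.finrank L ↥s = 2 → ∃ P ∈ B, P ≤ s)
    (hcard : (affinePart B).ncard = q ^ n)
    (hsec : ∀ s : Submodule L (L × L × L), Module.finrank L ↥s = 2 → s ≠ lineAtInfinity L →
      {P | P ∈ B ∧ P ≤ s}.ncard ∈ ({1, q + 1, q ^ (n - 2) + 1} : Set ℕ))
    (h00 : (0, 0) ∈ affinePart B) (h10 : (1, 0) ∈ affinePart B) (h01 : (0, 1) ∈ affinePart B)
    (hheavy : {P | P ∈ B ∧ P ≤ horizontalLine (0 : L)}.ncard = q ^ (n - 2) + 1) :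
    ∃ (m : ℕ) (a b c : L) (S : Submodule K⟮b⟯ L), a ≠ 0 ∧ b ≠ 0 ∧ c ≠ 0 ∧
      Module.finrank K K⟮b⟯ = m + 2 ∧ n = (m + 2) * (Module.finrank K⟮b⟯ S + 1) ∧
      (c • ((K⟮b⟯ : IntermediateField K L) : Set L)) ∩ (S : Set L) = {0} ∧
      (1 : L) ∈ S.restrictScalars K ⊔
          c • Submodule.span K (Set.range fun i : Fin (m + 1) => b ^ (i : ℕ)) ∧
      a ∉ S.restrictScalars K ⊔
          c • Submodule.span K (Set.range fun i : Fin (m + 1) => b ^ (i : ℕ)) ∧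
      B = {V : Submodule L (L × L × L) | ∃ v : L × L × L, v ≠ 0 ∧
            (∃ (x : Fin m → K) (α β δ : K) (s : L), s ∈ S ∧
              v = (s + (∑ i : Fin m, algebraMap K L (x i) * (c * b ^ (i : ℕ))) +
                    algebraMap K L α + algebraMap K L β * a,
                  algebraMap K L α + algebraMap K L β * b,
                  algebraMap K L δ)) ∧
            V = Submodule.span L {v}} := by
  classical
  have hq1 : 1 < q := hq ▸ Fintype.one_lt_card
  have hLcard : Nat.card L = q ^ n := by
    rw [Module.natCard_eq_pow_finrank (K := K), hn, Nat.card_eq_fintype_card, hq]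
  have hfin : ∀ p : L × L → Prop,
      {u | u ∈ affinePart B ∧ p u}.ncard = ((affinePart B).toFinset.filter p).card := by
    intro p
    rw [← Set.ncard_coe_finset]
    congr 1
    ext u
    simp
  have hoff : ∀ t : L, Submodule.span L {((t, 1, 0) : L × L × L)} ∉ B →
      ∀ s, {u | u ∈ affinePart B ∧ u.1 - t * u.2 = s}.ncard = 1 := by
    intro t ht
    refine ncard_fiber_eq_one _ (fun u => u.1 - t * u.2) (hcard.trans hLcard.symm) fun s => ?_
    obtain ⟨P, hP, hPs⟩ := hblock _ (finrank_obliqueLine t s)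
    have h := ncard_points_le_obliqueLine hBpts t s
    rw [if_neg ht, add_zero] at h
    rw [← h]
    exact Set.ncard_ne_zero_of_mem (a := P) ⟨hP, hPs⟩
  have hon : ∀ t : L, Submodule.span L {((t, 1, 0) : L × L × L)} ∈ B →
      ∀ s, {u | u ∈ affinePart B ∧ u.1 - t * u.2 = s}.ncard ∈ ({0, q, q ^ (n - 2)} : Set ℕ) := by
    intro t ht s
    have h := ncard_points_le_obliqueLine hBpts t s
    have h2 := hsec _ (finrank_obliqueLine t s) (obliqueLine_ne t s)
    rw [if_pos ht] at h
    rw [h] at h2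
    simp only [Set.mem_insert_iff, Set.mem_singleton_iff] at h2 ⊢
    omega
  have hhor : Submodule.span L {((1, 0, 0) : L × L × L)} ∈ B := by
    by_contra hno
    have h := ncard_fiber_eq_one (affinePart B) (fun u => u.2) (hcard.trans hLcard.symm)
      (fun s => by
        obtain ⟨P, hP, hPs⟩ := hblock _ (finrank_horizontalLine s)
        have h := ncard_points_le_horizontalLine hBpts s
        rw [if_neg hno, add_zero] at h
        rw [← h]
        exact Set.ncard_ne_zero_of_mem (a := P) ⟨hP, hPs⟩) 0
    have h2 := (Set.ncard_le_one (Set.toFinite _)).1 h.le (0, 0) ⟨h00, rfl⟩ (1, 0) ⟨h10, rfl⟩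
    simp at h2
  have hhor2 : {u | u ∈ affinePart B ∧ u.2 = 0}.ncard = q ^ (n - 2) := by
    have h := ncard_points_le_horizontalLine hBpts (0 : L)
    rw [if_pos hhor, hheavy] at h
    omega
  obtain ⟨M, hM, hMq⟩ := exists_submodule_of_line_cards (K := K) q n hq hqodd
    (by rw [← Nat.card_eq_fintype_card, hLcard]) hn5 (affinePart B).toFinset
    (by rw [← hcard, Set.ncard_eq_toFinset_card']) (by simpa using h00)
    (fun t => by
      by_cases ht : Submodule.span L {((t, 1, 0) : L × L × L)} ∈ B
      · right
        intro s
        rw [← hfin]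
        exact hon t ht s
      · left
        intro s
        rw [← hfin]
        exact hoff t ht s)
    (by rw [← hfin]; exact hhor2)
  rw [Set.coe_toFinset] at hM
  have hmem : ∀ u, u ∈ M ↔ u ∈ affinePart B := fun u => by rw [← hM]; rfl
  obtain ⟨m, a, b, c, S, ha, hb, hc, hm, hnm, hcS, h1, h2, hS⟩ := exists_standard_form q n hq hn
    (by omega) M (by rw [← hcard, ← hM]; rfl)
    (by
      rw [← hhor2, ← Nat.card_coe_set_eq]
      refine Nat.card_congr ⟨fun x => ⟨(x.1, 0), (hmem _).1 x.2, rfl⟩,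
        fun u => ⟨u.1.1, ?_⟩, fun x => rfl, fun u => Subtype.ext (Prod.ext rfl u.2.2.symm)⟩
      rw [Submodule.mem_comap, LinearMap.inl_apply,
        show ((u.1.1, 0) : L × L) = u.1 from Prod.ext rfl u.2.2.symm]
      exact (hmem _).2 u.2.1)
    ((hmem _).2 h10) ((hmem _).2 h01)
    (fun t => by
      simp only [hmem]
      rw [hfin]
      exact hMq t)
  refine ⟨m, a, b, c, S, ha, hb, hc, hm, hnm, hcS, h1, h2, ?_⟩
  have hset : ∀ V : Submodule L (L × L × L), V ∈ B ↔ ∃ u ∈ M, ∃ δ : K,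
      ((u.1, u.2, algebraMap K L δ) : L × L × L) ≠ 0 ∧
      V = Submodule.span L {((u.1, u.2, algebraMap K L δ) : L × L × L)} := by
    intro V
    constructor
    · intro hV
      obtain ⟨⟨x, y, z⟩, hv0, rfl⟩ := hBpts V hV
      by_cases hz : z = 0
      · subst hz
        by_cases hy : y = 0
        · subst hy
          refine ⟨(1, 0), (hmem _).2 h10, 0, by simp, ?_⟩
          rw [map_zero]
          exact span_eq_span_of_mem hv0 (Submodule.mem_span_singleton.2 ⟨x, by simp⟩)
        · have hV' : Submodule.span L {((x, y, 0) : L × L × L)} =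
              Submodule.span L {((x / y, 1, 0) : L × L × L)} :=
            span_eq_span_of_mem hv0 (Submodule.mem_span_singleton.2 ⟨y, by
              simp [mul_div_cancel₀ _ hy]⟩)
          rw [hV'] at hV
          have hcardu := hon _ hV 0
          have hmem0 : ((0, 0) : L × L) ∈ {u | u ∈ affinePart B ∧ u.1 - x / y * u.2 = 0} :=
            ⟨h00, by simp⟩
          have hgt : 1 < {u | u ∈ affinePart B ∧ u.1 - x / y * u.2 = 0}.ncard := by
            have h0 := Set.ncard_ne_zero_of_mem hmem0
            have h3 : 1 < q ^ (n - 2) := Nat.one_lt_pow (by omega) hq1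
            simp only [Set.mem_insert_iff, Set.mem_singleton_iff] at hcardu
            omega
          obtain ⟨u, ⟨hu, hut⟩, hu0⟩ := Set.exists_ne_of_one_lt_ncard hgt (0, 0)
          have hu2 : u ≠ 0 := hu0
          refine ⟨u, (hmem _).2 hu, 0, ?_, ?_⟩
          · intro h
            simp only [Prod.mk_eq_zero] at h
            exact hu2 (Prod.ext h.1 h.2.1)
          · rw [hV', map_zero]
            symm
            refine span_eq_span_of_mem ?_ (Submodule.mem_span_singleton.2 ⟨u.2, ?_⟩)
            · intro h
              simp only [Prod.mk_eq_zero] at h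
              exact hu2 (Prod.ext h.1 h.2.1)
            · ext
              · simp only [Prod.smul_mk, smul_eq_mul]
                linear_combination -hut
              · simp
              · simp
      · rw [span_eq_span_affine hz] at hV ⊢
        refine ⟨(x / z, y / z), (hmem _).2 hV, 1, by simp, by simp⟩
    · rintro ⟨u, hu, δ, hv0, rfl⟩
      by_cases hδ : δ = 0
      · subst hδ
        rw [map_zero] at hv0 ⊢
        by_cases hy : u.2 = 0
        · rw [span_eq_span_of_mem hv0 (w := (1, 0, 0))
            (Submodule.mem_span_singleton.2 ⟨u.1, by simp [hy]⟩)]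
          exact hhor
        · rw [span_eq_span_of_mem hv0 (w := (u.1 / u.2, 1, 0))
            (Submodule.mem_span_singleton.2 ⟨u.2, by simp [mul_div_cancel₀ _ hy]⟩)]
          by_contra hno
          have h := hoff _ hno 0
          have h2 := (Set.ncard_le_one (Set.toFinite _)).1 h.le (0, 0) ⟨h00, by simp⟩ u
            ⟨(hmem _).1 hu, by rw [div_mul_cancel₀ _ hy, sub_self]⟩
          rw [← h2] at hy
          exact hy rfl
      · have hδ' : algebraMap K L δ ≠ 0 := by simpa using hδ
        rw [span_eq_span_affine hδ']
        have h := (hmem _).1 (M.smul_mem δ⁻¹ hu)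
        convert h using 0
        simp [affinePart, Algebra.smul_def, div_eq_inv_mul]
  ext V
  rw [hset]
  constructor
  · rintro ⟨u, hu, δ, hv0, rfl⟩
    obtain ⟨x, α, β, s, hs, rfl⟩ := (hS u).1 hu
    exact ⟨_, hv0, ⟨x, α, β, δ, s, hs, rfl⟩, rfl⟩
  · rintro ⟨_, hv0, ⟨x, α, β, δ, s, hs, rfl⟩, rfl⟩
    exact ⟨_, (hS _).2 ⟨x, α, β, s, hs, rfl⟩, δ, hv0, rfl⟩

/-- Coordinates adapted to a line `linf` and a line `s₀` containing two affine points of `B`. -/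
theorem exists_normalizing_equiv {L : Type*} [Field L] [Finite L]
    (B : Set (Submodule L (L × L × L)))
    (hBpts : ∀ P ∈ B, ∃ v : L × L × L, v ≠ 0 ∧ P = Submodule.span L {v})
    (linf s₀ : Submodule L (L × L × L)) (hlinf : Module.finrank L linf = 2)
    (hs₀ : Module.finrank L s₀ = 2) (hne : s₀ ≠ linf)
    (h2 : 3 ≤ {P | P ∈ B ∧ P ≤ s₀}.ncard)
    (h3 : {P | P ∈ B ∧ P ≤ s₀}.ncard + {P | P ∈ B ∧ P ≤ linf}.ncard < B.ncard) :
    ∃ ψ : (L × L × L) ≃ₗ[L] (L × L × L),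
      (lineAtInfinity L).map ψ.toLinearMap = linf ∧ (horizontalLine 0).map ψ.toLinearMap = s₀ ∧
      Submodule.span L {ψ (0, 0, 1)} ∈ B ∧ Submodule.span L {ψ (1, 0, 1)} ∈ B ∧
      Submodule.span L {ψ (0, 1, 1)} ∈ B := by
  have hV : Module.finrank L (L × L × L) = 3 := by simp
  obtain ⟨θ, hθ0, hθle⟩ := Submodule.exists_le_ker_of_lt_top linf
    (lt_top_iff_ne_top.2 fun h => by rw [h, finrank_top] at hlinf; omega)
  have hθ : linf = LinearMap.ker θ := Submodule.eq_of_le_of_finrank_eq hθle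
    (hlinf.trans (finrank_ker_functional θ hθ0).symm)
  have hrep : ∀ P ∈ B, ¬ P ≤ linf → ∃ v, θ v = 1 ∧ P = Submodule.span L {v} := by
    intro P hP hPl
    obtain ⟨v, hv, rfl⟩ := hBpts P hP
    rw [Submodule.span_singleton_le_iff_mem, hθ, LinearMap.mem_ker] at hPl
    exact ⟨(θ v)⁻¹ • v, by simp [hPl],
      (Submodule.span_singleton_smul_eq (IsUnit.mk0 _ (inv_ne_zero hPl)) _).symm⟩
  have hinf : Module.finrank L ↥(s₀ ⊓ linf) ≤ 1 := by
    by_contra! hgt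
    have h4 : s₀ ⊓ linf = s₀ := Submodule.eq_of_le_of_finrank_le inf_le_left (by omega)
    have h5 : s₀ ⊓ linf = linf := Submodule.eq_of_le_of_finrank_le inf_le_right (by omega)
    exact hne (h4.symm.trans h5)
  have hone : {P | P ∈ B ∧ P ≤ s₀ ∧ P ≤ linf}.ncard ≤ 1 := by
    rw [Set.ncard_le_one (Set.toFinite _)]
    have key : ∀ P, P ∈ B → P ≤ s₀ ⊓ linf → P = s₀ ⊓ linf := by
      intro P hP hle
      obtain ⟨v, hv, rfl⟩ := hBpts P hP
      exact Submodule.eq_of_le_of_finrank_le hle (hinf.trans (finrank_span_singleton hv).ge)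
    rintro P ⟨hP, hPs, hPl⟩ Q ⟨hQ, hQs, hQl⟩
    rw [key P hP (le_inf hPs hPl), key Q hQ (le_inf hQs hQl)]
  have haff : 1 < ({P | P ∈ B ∧ P ≤ s₀} \ {P | P ∈ B ∧ P ≤ s₀ ∧ P ≤ linf}).ncard := by
    have := Set.le_ncard_sdiff {P | P ∈ B ∧ P ≤ s₀ ∧ P ≤ linf} {P | P ∈ B ∧ P ≤ s₀}
    omega
  obtain ⟨P, ⟨⟨hPB, hPs⟩, hPn⟩, P', ⟨⟨hPB', hPs'⟩, hPn'⟩, hPP⟩ :=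
    (Set.one_lt_ncard (Set.toFinite _)).1 haff
  obtain ⟨P'', hPB'', hPn''⟩ : (B \ ({P | P ∈ B ∧ P ≤ s₀} ∪ {P | P ∈ B ∧ P ≤ linf})).Nonempty := by
    refine Set.nonempty_of_ncard_ne_zero ?_
    have h4 := Set.le_ncard_sdiff ({P | P ∈ B ∧ P ≤ s₀} ∪ {P | P ∈ B ∧ P ≤ linf}) B
    have h5 := Set.ncard_union_le {P | P ∈ B ∧ P ≤ s₀} {P | P ∈ B ∧ P ≤ linf}
    omega
  obtain ⟨p, hp1, rfl⟩ := hrep P hPB fun h => hPn ⟨hPB, hPs, h⟩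
  obtain ⟨p', hp1', rfl⟩ := hrep P' hPB' fun h => hPn' ⟨hPB', hPs', h⟩
  obtain ⟨p'', hp1'', rfl⟩ := hrep P'' hPB'' fun h => hPn'' (Or.inr ⟨hPB'', h⟩)
  have hps : p ∈ s₀ := (Submodule.span_singleton_le_iff_mem _ _).1 hPs
  have hps' : p' ∈ s₀ := (Submodule.span_singleton_le_iff_mem _ _).1 hPs'
  have hps'' : p'' ∉ s₀ := fun h =>
    hPn'' (Or.inl ⟨hPB'', (Submodule.span_singleton_le_iff_mem _ _).2 h⟩)
  have hpp : p' - p ≠ 0 := fun h => hPP (by rw [sub_eq_zero.1 h])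
  let f : (L × L × L) →ₗ[L] (L × L × L) :=
    (LinearMap.toSpanSingleton L _ (p' - p)).coprod
      ((LinearMap.toSpanSingleton L _ (p'' - p)).coprod (LinearMap.toSpanSingleton L _ p))
  have hf : ∀ v, f v = v.1 • (p' - p) + (v.2.1 • (p'' - p) + v.2.2 • p) := fun v => rfl
  have hfθ : ∀ v, θ (f v) = v.2.2 := by
    intro v
    simp [hf, hp1, hp1', hp1'']
  have hfs : ∀ v, f v ∈ s₀ → v.2.1 = 0 := by
    intro v hv
    by_contra hy
    refine hps'' ?_
    have h5 : v.2.1 • p'' ∈ s₀ := by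
      have := s₀.sub_mem (s₀.sub_mem hv (s₀.smul_mem v.1 (s₀.sub_mem hps' hps)))
        (s₀.smul_mem (v.2.2 - v.2.1) hps)
      convert this using 1
      rw [hf]
      module
    exact (s₀.smul_mem_iff hy).1 h5
  have hinj : Function.Injective f := by
    rw [← LinearMap.ker_eq_bot, LinearMap.ker_eq_bot']
    intro v hv
    have hz : v.2.2 = 0 := by rw [← hfθ, hv, map_zero]
    have hy : v.2.1 = 0 := hfs v (by rw [hv]; exact s₀.zero_mem)
    have hx : v.1 = 0 := by
      rw [hf, hy, hz, zero_smul, zero_smul, add_zero, add_zero] at hv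
      exact (smul_eq_zero.1 hv).resolve_right hpp
    exact Prod.ext hx (Prod.ext hy hz)
  let ψ := LinearEquiv.ofInjectiveEndo f hinj
  have hψ : ∀ v, ψ v = f v := fun v => rfl
  have hfin : ∀ s : Submodule L (L × L × L), Module.finrank L (s.map ψ.toLinearMap) =
      Module.finrank L s := fun s => LinearEquiv.finrank_map_eq ψ s
  refine ⟨ψ, ?_, ?_, ?_, ?_, ?_⟩
  · refine Submodule.eq_of_le_of_finrank_eq ?_ ?_
    · rintro _ ⟨v, hv, rfl⟩
      rw [hθ, LinearMap.mem_ker]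
      exact (hfθ v).trans hv
    · rw [hfin, hlinf]
      exact finrank_ker_functional _ fun h => by
        have := LinearMap.congr_fun h (0, 0, 1)
        simp at this
  · refine Submodule.eq_of_le_of_finrank_eq ?_ ?_
    · rintro _ ⟨v, hv, rfl⟩
      have hy : v.2.1 = 0 := by simpa [mem_horizontalLine] using hv
      change f v ∈ s₀
      rw [hf, hy, zero_smul, zero_add]
      exact s₀.add_mem (s₀.smul_mem _ (s₀.sub_mem hps' hps)) (s₀.smul_mem _ hps)
    · rw [hfin, hs₀, finrank_horizontalLine]
  · simpa [hψ, hf] using hPB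
  · simpa [hψ, hf] using hPB'
  · simpa [hψ, hf] using hPB''

set_option synthInstance.maxHeartbeats 1000000 in
set_option maxHeartbeats 1000000 in
/-- Theorem `th:classRedeibs`: classification of small minimal blocking
sets of Rédei type in `PG(2,q^n)` whose non-Rédei lines meet them in `1`, `q+1` or
`q^{n-2}+1` points. Points of `PG(2,q^n)` are the one-dimensional `𝔽_{q^n}`-subspaces
of `𝔽_{q^n}³`, lines the two-dimensional ones, with incidence given by inclusion. -/
theorem stmt_17 (q n : ℕ) (K L : Type*) [Field K] [Field L] [Algebra K L]
    [Fintype K] [Fintype L]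
    (hq : Fintype.card K = q) (hqodd : Odd q)
    (hn : Module.finrank K L = n) (hn5 : 5 ≤ n)
    (B : Set (Submodule L (L × L × L)))
    -- B is a set of points
    (hBpts : ∀ P ∈ B, ∃ v : L × L × L, v ≠ 0 ∧ P = Submodule.span L {v})
    -- B is a blocking set
    (hblock : ∀ s : Submodule L (L × L × L), Module.finrank L ↥s = 2 → ∃ P ∈ B, P ≤ s)
    -- B is minimal
    (hmin : ∀ B' : Set (Submodule L (L × L × L)), B' ⊆ B → B' ≠ B →
      ¬ ∀ s : Submodule L (L × L × L), Module.finrank L ↥s = 2 → ∃ P ∈ B', P ≤ s)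
    -- B is small: |B| ≤ 3(q^n+1)/2
    (hsmall : 2 * B.ncard ≤ 3 * (q ^ n + 1))
    -- B is of Rédei type with Rédei line ℓ∞
    (linf : Submodule L (L × L × L)) (hlinf : Module.finrank L ↥linf = 2)
    (hRedei1 : {P | P ∈ B ∧ P ≤ linf}.ncard < q ^ n)
    (hRedei2 : B.ncard = q ^ n + {P | P ∈ B ∧ P ≤ linf}.ncard)
    -- intersection numbers of lines other than ℓ∞
    (hsec : ∀ s : Submodule L (L × L × L), Module.finrank L ↥s = 2 → s ≠ linf →
      {P | P ∈ B ∧ P ≤ s}.ncard ∈ ({1, q + 1, q ^ (n - 2) + 1} : Set ℕ))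
    (hsec1 : ∃ s : Submodule L (L × L × L), Module.finrank L ↥s = 2 ∧ s ≠ linf ∧
      {P | P ∈ B ∧ P ≤ s}.ncard = 1)
    (hsec2 : ∃ s : Submodule L (L × L × L), Module.finrank L ↥s = 2 ∧ s ≠ linf ∧
      {P | P ∈ B ∧ P ≤ s}.ncard = q + 1)
    (hsec3 : ∃ s : Submodule L (L × L × L), Module.finrank L ↥s = 2 ∧ s ≠ linf ∧
      {P | P ∈ B ∧ P ≤ s}.ncard = q ^ (n - 2) + 1) :
    ∃ (σ : (L × L × L) ≃ₗ[L] (L × L × L)) (t ℓ : ℕ) (a b c : L),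
      2 ≤ t ∧ n = t * (ℓ + 1) ∧ a ≠ 0 ∧ b ≠ 0 ∧ c ≠ 0 ∧
      Module.finrank K ↥(IntermediateField.adjoin K {b}) = t ∧
      ∃ S' : Submodule ↥(IntermediateField.adjoin K {b}) L,
        Module.finrank ↥(IntermediateField.adjoin K {b}) ↥S' = ℓ ∧
        (c • ((IntermediateField.adjoin K {b} : IntermediateField K L) : Set L)) ∩
          (S' : Set L) = {0} ∧
        (1 : L) ∈ S'.restrictScalars K ⊔
          c • Submodule.span K (Set.range fun i : Fin (t - 1) => b ^ (i : ℕ)) ∧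
        a ∉ S'.restrictScalars K ⊔
          c • Submodule.span K (Set.range fun i : Fin (t - 1) => b ^ (i : ℕ)) ∧
        (fun P : Submodule L (L × L × L) => Submodule.map σ.toLinearMap P) '' B =
          {V : Submodule L (L × L × L) | ∃ v : L × L × L, v ≠ 0 ∧
            (∃ (x : Fin (t - 2) → K) (α β δ : K) (s : L), s ∈ S' ∧
              v = (s + (∑ i : Fin (t - 2), algebraMap K L (x i) * (c * b ^ (i : ℕ))) +
                    algebraMap K L α + algebraMap K L β * a,
                  algebraMap K L α + algebraMap K L β * b,
                  algebraMap K L δ)) ∧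
            V = Submodule.span L {v}} := by
  classical
  have hq1 : 1 < q := hq ▸ Fintype.one_lt_card
  obtain ⟨s₀, hs₀, hne, hs₀c⟩ := hsec3
  have hpow1 : q < q ^ (n - 2) := by simpa using Nat.pow_lt_pow_right hq1 (show 1 < n - 2 by omega)
  have hpow2 : q ^ (n - 2) * 4 ≤ q ^ n := by
    rw [show n = n - 2 + 2 by omega, pow_add, Nat.add_sub_cancel]
    exact Nat.mul_le_mul_left _ (by nlinarith)
  obtain ⟨ψ, hψl, hψs, h00, h10, h01⟩ := exists_normalizing_equiv B hBpts linf s₀ hlinf hs₀ hne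
    (by omega) (by omega)
  let e := Submodule.orderIsoMapComap ψ
  have he : ∀ s, e s = s.map ψ.toLinearMap := fun s => rfl
  have hfin : ∀ s, Module.finrank L ↥(e s) = Module.finrank L s := fun s =>
    LinearEquiv.finrank_map_eq ψ s
  have hncard : ∀ s, {P | P ∈ e ⁻¹' B ∧ P ≤ s}.ncard = {P | P ∈ B ∧ P ≤ e s}.ncard := by
    intro s
    rw [← Set.ncard_image_of_injective _ e.injective]
    congr 1
    ext P
    constructor
    · rintro ⟨Q, ⟨hQ, hQs⟩, rfl⟩
      exact ⟨hQ, e.monotone hQs⟩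
    · rintro ⟨hP, hPs⟩
      exact ⟨e.symm P, ⟨by simpa using hP, by simpa using e.symm.monotone hPs⟩, by simp⟩
  have hpts : ∀ P ∈ e ⁻¹' B, ∃ v : L × L × L, v ≠ 0 ∧ P = Submodule.span L {v} := by
    intro P hP
    obtain ⟨v, hv, hPv⟩ := hBpts _ hP
    refine ⟨ψ.symm v, by simpa using hv, e.injective ?_⟩
    rw [hPv, he, Submodule.map_span, Set.image_singleton]
    simp
  have hspan : ∀ v, e (Submodule.span L {v}) = Submodule.span L {ψ v} := by
    intro v
    rw [he, Submodule.map_span, Set.image_singleton]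
    rfl
  have hcard : (affinePart (e ⁻¹' B)).ncard = q ^ n := by
    have h := ncard_affinePart hpts
    rw [hncard, he, hψl] at h
    have h2 : (e ⁻¹' B).ncard = B.ncard :=
      Set.ncard_preimage_of_injective_subset_range e.injective (by simp [e.surjective.range_eq])
    omega
  obtain ⟨m, a, b, c, S, ha, hb, hc, hm, hnm, hcS, h1, h2, hB⟩ :=
    exists_coordinates_of_normalized q n hq hqodd hn hn5 (e ⁻¹' B) hpts
      (fun s hs => by
        obtain ⟨P, hP, hPs⟩ := hblock (e s) ((hfin s).trans hs)
        exact ⟨e.symm P, by simpa using hP, by simpa using e.symm.monotone hPs⟩)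
      hcard
      (fun s hs hsl => by
        rw [hncard]
        refine hsec _ ((hfin s).trans hs) fun h => hsl (e.injective ?_)
        rw [h, he, hψl])
      (by rw [← hspan] at h00; exact h00) (by rw [← hspan] at h10; exact h10)
      (by rw [← hspan] at h01; exact h01)
      (by rw [hncard, he, hψs, hs₀c])
  refine ⟨ψ.symm, m + 2, Module.finrank (IntermediateField.adjoin K {b}) S, a, b, c,
    Nat.le_add_left _ _, hnm, ha, hb, hc, hm, S, rfl, hcS, h1, h2, ?_⟩
  refine Eq.trans ?_ hB
  have hsymm : ∀ P : Submodule L (L × L × L), P.map ψ.symm.toLinearMap = e.symm P := by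
    intro P
    rw [OrderIso.eq_symm_apply, he, ← Submodule.map_comp]
    simp
  ext V
  simp only [Set.mem_image, Set.mem_preimage, hsymm]
  constructor
  · rintro ⟨P, hP, rfl⟩
    simpa using hP
  · intro hV
    exact ⟨e V, hV, by simp⟩
end

section
/- Let f(x) = a_0 x + a_1 x^q + a_2 x^{q²} be a q-polynomial over 𝔽_{q³}. Then f is scattered over 𝔽_{q³} (i.e. dim_{𝔽_q}{x ∈ 𝔽_{q³} : f(x) = αx} ≤ 1 for every α ∈ 𝔽_{q³}) if and only if either a_1 = 0 and a_2 ≠ 0, or a_1 ≠ 0 and N_{q³/q}(a_2/a_1) ≠ 1. -/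
open scoped Pointwise

namespace FiniteField

variable {K L : Type*} [Field K] [Field L] [Algebra K L] [Fintype K]

local notation "q" => Fintype.card K

theorem sub_pow_card_of_algebra (K : Type*) {L : Type*} [Field K] [Field L] [Algebra K L]
    [Fintype K] (x y : L) : (x - y) ^ Fintype.card K = x ^ Fintype.card K - y ^ Fintype.card K :=
  map_sub (frobeniusAlgHom K L) x y

theorem mem_range_algebraMap_iff_pow_card_eq [Finite L] (x : L) :
    x ∈ Set.range (algebraMap K L) ↔ x ^ q = x := by
  constructor
  · rintro ⟨k, rfl⟩
    rw [← map_pow, pow_card]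
  · intro h
    rw [IsGalois.mem_range_algebraMap_iff_fixed]
    intro g
    obtain ⟨n, rfl⟩ := (bijective_frobeniusAlgEquivOfAlgebraic_pow K L).2 g
    have hx : Function.IsFixedPt (frobeniusAlgEquivOfAlgebraic K L) x := h
    rw [AlgEquiv.coe_pow]
    exact hx.iterate n

/-- The alternating form `x ^ q * y - y ^ q * x` detects linear dependence over `𝔽_q`. -/
theorem pow_card_mul_sub_eq_zero_iff [Finite L] {x : L} (hx : x ≠ 0) (y : L) :
    x ^ q * y - y ^ q * x = 0 ↔ ∃ μ : K, y = μ • x := by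
  have h : x ^ q * y - y ^ q * x = 0 ↔ y / x ∈ Set.range (algebraMap K L) := by
    rw [mem_range_algebraMap_iff_pow_card_eq, div_pow, div_eq_div_iff (pow_ne_zero _ hx) hx,
      sub_eq_zero, mul_comm y, eq_comm]
  rw [h]
  simp only [Set.mem_range, Algebra.smul_def, eq_div_iff hx, eq_comm]

theorem norm_eq_one_of_eq_mul_pow [Finite L] {c w : L} (hw : w ≠ 0) (h : w = c * (w ^ q) ^ q) :
    Algebra.norm K c = 1 := by
  have hN : Algebra.norm K w ≠ 0 := Algebra.norm_ne_zero_iff.2 hw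
  have hnorm := congrArg (Algebra.norm K) h
  rw [map_mul, map_pow, map_pow, pow_card, pow_card] at hnorm
  exact mul_right_cancel₀ hN (by rw [one_mul, ← hnorm])

section Cubic

variable [Fintype L] (hn : Module.finrank K L = 3)
include hn

theorem pow_card_pow_three_of_finrank (x : L) : ((x ^ q) ^ q) ^ q = x := by
  have h : Fintype.card L = q ^ 3 := by rw [Module.card_eq_pow_finrank (K := K), hn]
  calc ((x ^ q) ^ q) ^ q = x ^ q ^ 3 := by ring
    _ = x := by rw [← h, pow_card]

theorem algebraMap_norm_of_finrank_eq_three (x : L) :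
    algebraMap K L (Algebra.norm K x) = x * x ^ q * (x ^ q) ^ q := by
  rw [algebraMap_norm_eq_prod_pow, hn]
  simp [Finset.prod_range_succ, Nat.card_eq_fintype_card, ← pow_mul, pow_two]

/-- Up to `𝔽_q`-multiples, every nonzero element of `𝔽_{q³}` is a value of the alternating form
`x ^ q * y - y ^ q * x`. -/
theorem exists_pow_card_mul_sub_eq_smul {w : L} (hw : w ≠ 0) :
    ∃ x y : L, x ≠ 0 ∧ ∃ κ : K, κ ≠ 0 ∧ x ^ q * y - y ^ q * x = κ • w := by
  obtain ⟨t, ht⟩ : ∃ t : L, t ∉ Set.range (algebraMap K L) := by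
    by_contra! h
    have hb := Algebra.finrank_eq_of_equiv_equiv (RingEquiv.refl K)
      (RingEquiv.ofBijective (algebraMap K L) ⟨(algebraMap K L).injective, h⟩) rfl
    simp [hn] at hb
  have ht0 : t - t ^ q ≠ 0 := fun h ↦
    ht ((mem_range_algebraMap_iff_pow_card_eq t).2 (sub_eq_zero.1 h).symm)
  have hu : (t - t ^ q) / w ≠ 0 := div_ne_zero ht0 hw
  set u := (t - t ^ q) / w with hu_def
  have huw : t - t ^ q = u * w := by rw [hu_def, div_mul_cancel₀ _ hw]
  refine ⟨u ^ q, u ^ q * t, pow_ne_zero _ hu, Algebra.norm K u, Algebra.norm_ne_zero_iff.2 hu, ?_⟩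
  rw [Algebra.smul_def, algebraMap_norm_of_finrank_eq_three hn, mul_pow]
  linear_combination (u ^ q) ^ q * u ^ q * huw

theorem exists_add_mul_pow_add_mul_pow_ne_zero {a : L} (ha : a ≠ 0) (b d : L) :
    ∃ z : L, a * z + b * z ^ q + d * (z ^ q) ^ q ≠ 0 := by
  by_contra! h
  have hli := (linearIndependent_algHom_toLinearMap K L L).comp _
    (bijective_frobeniusAlgHom_pow K L).1
  rw [← linearIndependent_equiv (finCongr hn.symm), Fintype.linearIndependent_iff] at hli
  refine ha (hli ![a, b, d] (LinearMap.ext fun z ↦ ?_) 0)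
  simpa [Fin.sum_univ_three, pow_two] using h z

/-- Hilbert 90 for the square of the Frobenius of `𝔽_{q³}` over `𝔽_q`. -/
theorem exists_eq_mul_pow_of_norm_eq_one {c : L} (hc : Algebra.norm K c = 1) :
    ∃ w : L, w ≠ 0 ∧ w = c * (w ^ q) ^ q := by
  obtain ⟨z, hz⟩ :=
    exists_add_mul_pow_add_mul_pow_ne_zero hn one_ne_zero (c * (c ^ q) ^ q) c
  refine ⟨_, hz, ?_⟩
  have hN := algebraMap_norm_of_finrank_eq_three hn c
  rw [hc, map_one] at hN
  have hadd (x y : L) : (x + y) ^ q = x ^ q + y ^ q := map_add (frobeniusAlgHom K L) x y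
  simp only [hadd, mul_pow, one_pow, pow_card_pow_three_of_finrank hn]
  linear_combination z * hN

theorem exists_mul_eq_mul_pow_iff (a b : L) :
    (∀ w : L, a * w = b * (w ^ q) ^ q → w = 0) ↔
      ((a = 0 ∧ b ≠ 0) ∨ (a ≠ 0 ∧ Algebra.norm K (b / a) ≠ 1)) := by
  rcases eq_or_ne a 0 with rfl | ha
  · rcases eq_or_ne b 0 with rfl | hb
    · simpa using ⟨(1 : L), one_ne_zero⟩
    · simp [hb, eq_comm]
  · have key (w : L) : a * w = b * (w ^ q) ^ q ↔ w = b / a * (w ^ q) ^ q := by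
      rw [div_mul_eq_mul_div, eq_div_iff ha, mul_comm a]
    simp only [key, ha, false_and, ne_eq, not_false_eq_true, true_and, false_or]
    constructor
    · intro h hc
      obtain ⟨w, hw, hcw⟩ := exists_eq_mul_pow_of_norm_eq_one hn hc
      exact hw (h w hcw)
    · intro h w hw
      by_contra h0
      exact h (norm_eq_one_of_eq_mul_pow h0 hw)

end Cubic

end FiniteField

open FiniteField in
/-- a `q`-polynomial `f(x) = a₀x + a₁x^q + a₂x^{q²}` over `𝔽_{q³}`
is scattered if and only if either `a₁ = 0` and `a₂ ≠ 0`, or `a₁ ≠ 0` and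
`N_{q³/q}(a₂/a₁) ≠ 1`. Scatteredness is expressed by saying that every "eigenspace"
`{x : f(x) = αx}` has `𝔽_q`-dimension at most 1, i.e. any two of its elements with the
first nonzero are `𝔽_q`-proportional. -/
theorem stmt_19 (q : ℕ) (K L : Type*) [Field K] [Field L] [Algebra K L]
    [Fintype K] [Fintype L]
    (hq : Fintype.card K = q) (hn : Module.finrank K L = 3)
    (a₀ a₁ a₂ : L) (f : L → L)
    (hf : ∀ x, f x = a₀ * x + a₁ * x ^ q + a₂ * x ^ q ^ 2) :
    (∀ α x y : L, f x = α * x → f y = α * y → x ≠ 0 → ∃ μ : K, y = μ • x) ↔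
      ((a₁ = 0 ∧ a₂ ≠ 0) ∨ (a₁ ≠ 0 ∧ Algebra.norm K (a₂ / a₁) ≠ 1)) := by
  subst hq
  rw [← exists_mul_eq_mul_pow_iff hn]
  set q := Fintype.card K
  have key (x y : L) : f x * y - f y * x =
      a₁ * (x ^ q * y - y ^ q * x) - a₂ * ((x ^ q * y - y ^ q * x) ^ q) ^ q := by
    simp only [hf, q, sub_pow_card_of_algebra K, mul_pow, pow_card_pow_three_of_finrank hn, pow_two,
      pow_mul]
    ring
  constructor
  · intro h w hw
    by_contra h0
    obtain ⟨x, y, hx, κ, hκ, hxy⟩ := exists_pow_card_mul_sub_eq_smul hn h0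
    have hfxy : f x * y - f y * x = 0 := by
      rw [key, hxy, Algebra.smul_def, mul_pow, mul_pow, ← map_pow, ← map_pow, pow_card, pow_card]
      linear_combination algebraMap K L κ * hw
    have hdep := h (f x / x) x y (div_mul_cancel₀ _ hx).symm
      (by rw [div_mul_eq_mul_div, eq_div_iff hx]; exact (sub_eq_zero.1 hfxy).symm) hx
    rw [← pow_card_mul_sub_eq_zero_iff hx, hxy] at hdep
    exact smul_ne_zero hκ h0 hdep
  · intro h α x y hfx hfy hx
    rw [← pow_card_mul_sub_eq_zero_iff hx]
    refine h _ (sub_eq_zero.1 ?_)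
    rw [← key, hfx, hfy]
    ring
end
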